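/- arXiv:2011.01053 — 3 statements merged into one kernel-verified Lean document; each statement's English description precedes it below -/
import Mathlib

section
/- Let n ≥ 1 be an integer and r ≥ 1 a real number such that rn is an integer. Then every (n, n, rn)-fractionally balanced tripartite hypergraph contains a matching of size ⌈⌊2r⌋·n/(⌊2r⌋+2)⌉ and also a matching of size ⌈2rn/(⌈2r⌉+2)⌉. -/
/-- `f` is a balanced weight function on the tripartite hypergraph `H`:
nonnegative, vanishing outside `H`, with constant degrees on each of the three sides. -/
def TriBalanced {a b c : ℕ} (H : Finset (Fin a × Fin b × Fin c))
    (f : Fin a × Fin b × Fin c → ℝ) : Prop :=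
  (∀ e, 0 ≤ f e) ∧ (∀ e, e ∉ H → f e = 0) ∧
    (∀ v w : Fin a, (∑ e : Fin a × Fin b × Fin c, if e.1 = v then f e else 0) =
      ∑ e : Fin a × Fin b × Fin c, if e.1 = w then f e else 0) ∧
    (∀ v w : Fin b, (∑ e : Fin a × Fin b × Fin c, if e.2.1 = v then f e else 0) =
      ∑ e : Fin a × Fin b × Fin c, if e.2.1 = w then f e else 0) ∧
    (∀ v w : Fin c, (∑ e : Fin a × Fin b × Fin c, if e.2.2 = v then f e else 0) =
      ∑ e : Fin a × Fin b × Fin c, if e.2.2 = w then f e else 0)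

/-- `H` is an `(a,b,c)`-fractionally balanced tripartite hypergraph. -/
def TriFracBalanced {a b c : ℕ} (H : Finset (Fin a × Fin b × Fin c)) : Prop :=
  ∃ f, TriBalanced H f ∧ f ≠ 0

/-- `M` is a matching in `H`: a set of edges of `H` any two distinct members of
which differ in all three coordinates. -/
def TriMatching {a b c : ℕ} (H M : Finset (Fin a × Fin b × Fin c)) : Prop :=
  M ⊆ H ∧ ∀ e ∈ M, ∀ f ∈ M, e ≠ f → e.1 ≠ f.1 ∧ e.2.1 ≠ f.2.1 ∧ e.2.2 ≠ f.2.2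


open Classical in
/-- Boundary of a mod 2 chain. -/
noncomputable def tbd {V : Type*} [Fintype V] (z : Finset V → ZMod 2) : Finset V → ZMod 2 :=
  fun t => ∑ a, if a ∈ t then 0 else z (insert a t)

open Classical in
/-- Cone of a mod 2 chain. -/
noncomputable def tcone {V : Type*} (x : V) (z : Finset V → ZMod 2) : Finset V → ZMod 2 :=
  fun s => if x ∈ s then z (s.erase x) else 0

/-- `z` is a chain of independent sets of size `j` inside `U`. -/
def IsCh {V : Type*} (G : SimpleGraph V) (U : Finset V) (j : ℕ) (z : Finset V → ZMod 2) : Prop :=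
  ∀ s, z s ≠ 0 → s ⊆ U ∧ s.card = j ∧ ∀ a ∈ s, ∀ b ∈ s, ¬ G.Adj a b

/-- Acyclicity of the independence complex of `G` on `U` in low degrees. -/
def Acyc {V : Type*} [Fintype V] (G : SimpleGraph V) (U : Finset V) (k : ℕ) : Prop :=
  ∀ j < k, ∀ z, IsCh G U j z → tbd z = 0 → ∃ w, IsCh G U (j + 1) w ∧ tbd w = z

section
set_option linter.unusedSectionVars false
variable {V : Type*} [Fintype V]

theorem tbd_add (z w : Finset V → ZMod 2) : tbd (z + w) = tbd z + tbd w := by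
  classical
  funext t
  simp only [tbd, Pi.add_apply, ← Finset.sum_add_distrib]
  refine Finset.sum_congr rfl fun a _ => ?_
  split_ifs <;> simp

theorem tbd_zero : tbd (0 : Finset V → ZMod 2) = 0 := by
  classical
  funext t
  simp [tbd]

theorem tbd_sum {ι : Type*} (S : Finset ι) (F : ι → Finset V → ZMod 2) :
    tbd (∑ i ∈ S, F i) = ∑ i ∈ S, tbd (F i) := by
  classical
  induction S using Finset.induction_on with
  | empty => simp [tbd_zero]
  | insert a s ha ih => rw [Finset.sum_insert ha, Finset.sum_insert ha, tbd_add, ih]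

theorem tcone_zero (x : V) : tcone x (0 : Finset V → ZMod 2) = 0 := by
  funext t
  simp [tcone]

theorem tcone_add (x : V) (z w : Finset V → ZMod 2) : tcone x (z + w) = tcone x z + tcone x w := by
  classical
  funext t
  simp only [tcone, Pi.add_apply]
  split_ifs <;> simp

theorem ch_add_self (z : Finset V → ZMod 2) : z + z = 0 := by
  funext t
  exact CharTwo.add_self_eq_zero (z t)

theorem tbd_tcone (x : V) (z : Finset V → ZMod 2) : tbd (tcone x z) = z + tcone x (tbd z) := by
  classical
  funext t
  simp only [tbd, tcone, Pi.add_apply]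
  by_cases hx : x ∈ t
  · simp only [hx, if_true, Finset.mem_insert, or_true]
    have h1 : ∀ a : V, (if a ∈ t.erase x then (0 : ZMod 2) else z (insert a (t.erase x))) =
        (if a ∈ t then 0 else z ((insert a t).erase x)) + (if a = x then z t else 0) := by
      intro a
      by_cases ha : a = x
      · subst ha
        simp [hx, Finset.insert_erase hx]
      · by_cases hat : a ∈ t
        · simp [ha, hat]
        · simp only [Finset.mem_erase, ne_eq, ha, not_false_eq_true, hat, and_false, if_false,
            add_zero]
          rw [Finset.erase_insert_of_ne ha]
    rw [Finset.sum_congr rfl fun a _ => h1 a, Finset.sum_add_distrib]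
    simp only [Finset.sum_ite_eq', Finset.mem_univ, if_true]
    rw [add_comm, add_assoc, CharTwo.add_self_eq_zero, add_zero]
  · simp only [hx, if_false, add_zero, Finset.mem_insert, or_false]
    rw [Finset.sum_eq_single x]
    · simp [hx]
    · intro b _ hb
      have : x ≠ b := fun h => hb h.symm
      simp [this]
    · simp

theorem acyc_isolated (G : SimpleGraph V) (U : Finset V) (k : ℕ) (x : V) (hx : x ∈ U)
    (hiso : ∀ y ∈ U, ¬ G.Adj x y) : Acyc G U k := by
  classical
  intro j _ z hz hbd
  refine ⟨tcone x z, ?_, ?_⟩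
  · intro s hs
    have hxs : x ∈ s := by
      by_contra h
      simp [tcone, h] at hs
    have hs' : z (s.erase x) ≠ 0 := by simpa [tcone, hxs] using hs
    obtain ⟨h1, h2, h3⟩ := hz _ hs'
    have hsU : s ⊆ U := by
      intro a ha
      by_cases hax : a = x
      · rwa [hax]
      · exact h1 (Finset.mem_erase.2 ⟨hax, ha⟩)
    refine ⟨hsU, ?_, ?_⟩
    · rw [← Finset.card_erase_add_one hxs, h2]
    · intro a ha b hb hab
      by_cases hax : a = x
      · subst hax; exact hiso b (hsU hb) hab
      by_cases hbx : b = x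
      · subst hbx; exact hiso a (hsU ha) hab.symm
      exact h3 a (Finset.mem_erase.2 ⟨hax, ha⟩) b (Finset.mem_erase.2 ⟨hbx, hb⟩) hab
  · rw [tbd_tcone, hbd, tcone_zero, add_zero]

open Classical in
theorem acyc_explode (G : SimpleGraph V) (U : Finset V) (k : ℕ) (x y : V) (hx : x ∈ U) (hy : y ∈ U)
    (hxy : G.Adj x y) (hdel : Acyc (G.deleteEdges {s(x, y)}) U (k + 1))
    (hexp : Acyc G (U.filter fun v => ¬ (G.Adj x v ∨ G.Adj y v)) k) : Acyc G U (k + 1) := by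
  intro j hj z hz hbd
  have hne : x ≠ y := hxy.ne
  have hz' : IsCh (G.deleteEdges {s(x, y)}) U j z := by
    intro s hs
    obtain ⟨h1, h2, h3⟩ := hz s hs
    exact ⟨h1, h2, fun a ha b hb hab => h3 a ha b hb ((SimpleGraph.deleteEdges_le _) hab)⟩
  obtain ⟨w, hw, hwz⟩ := hdel j hj z hz' hbd
  have key : ∀ s, w s ≠ 0 → ¬ (x ∈ s ∧ y ∈ s) → ∀ a ∈ s, ∀ b ∈ s, ¬ G.Adj a b := by
    intro s hs hns a ha b hb hab
    apply (hw s hs).2.2 a ha b hb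
    rw [SimpleGraph.deleteEdges_adj]
    refine ⟨hab, ?_⟩
    simp only [Set.mem_singleton_iff, Sym2.eq_iff]
    rintro (⟨rfl, rfl⟩ | ⟨rfl, rfl⟩)
    · exact hns ⟨ha, hb⟩
    · exact hns ⟨hb, ha⟩
  rcases j with _ | j
  · refine ⟨w, ?_, hwz⟩
    intro s hs
    refine ⟨(hw s hs).1, (hw s hs).2.1, key s hs ?_⟩
    rintro ⟨h1, h2⟩
    exact hne (Finset.card_le_one.1 (hw s hs).2.1.le x h1 y h2)
  set u : Finset V → ZMod 2 := fun s => if x ∈ s ∨ y ∈ s then 0 else w (insert x (insert y s))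
    with hu
  have huc : IsCh G (U.filter fun v => ¬ (G.Adj x v ∨ G.Adj y v)) j u := by
    intro s hs
    have hns : ¬ (x ∈ s ∨ y ∈ s) := by
      intro h; simp [hu, h] at hs
    have hs' : w (insert x (insert y s)) ≠ 0 := by simpa [hu, hns] using hs
    obtain ⟨h1, h2, h3⟩ := hw _ hs'
    push Not at hns
    have adj : ∀ a ∈ insert x (insert y s), ∀ b ∈ s, ¬ G.Adj a b := by
      intro a ha b hb hab
      apply h3 a ha b (by simp [hb])
      rw [SimpleGraph.deleteEdges_adj]
      refine ⟨hab, ?_⟩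
      simp only [Set.mem_singleton_iff, Sym2.eq_iff]
      rintro (⟨rfl, rfl⟩ | ⟨rfl, rfl⟩)
      · exact hns.2 hb
      · exact hns.1 hb
    refine ⟨?_, ?_, ?_⟩
    · intro a ha
      rw [Finset.mem_filter]
      refine ⟨h1 (by simp [ha]), ?_⟩
      rintro (h | h)
      · exact adj x (by simp) a ha h
      · exact adj y (by simp) a ha h
    · rw [Finset.card_insert_of_notMem, Finset.card_insert_of_notMem hns.2] at h2
      · omega
      · simp [hns.1, hne]
    · intro a ha b hb
      exact adj a (by simp [ha]) b hb
  have hub : tbd u = 0 := by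
    funext t
    by_cases ht : x ∈ t ∨ y ∈ t
    · simp only [tbd, Pi.zero_apply]
      refine Finset.sum_eq_zero fun a _ => ?_
      have : x ∈ insert a t ∨ y ∈ insert a t := by
        rcases ht with h | h <;> simp [h]
      simp only [hu]
      rw [if_pos this, ite_self]
    · have h1 : tbd u t = tbd w (insert x (insert y t)) := by
        simp only [tbd]
        refine Finset.sum_congr rfl fun a _ => ?_
        push Not at ht
        by_cases hax : a = x
        · subst hax; simp [hu]
        by_cases hay : a = y
        · subst hay; simp [hu]
        have hxa : x ≠ a := fun h => hax h.symm
        have hya : y ≠ a := fun h => hay h.symm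
        simp only [hu, Finset.mem_insert, hax, hay, hxa, hya, ht.1, ht.2, false_or, or_self,
          if_false]
        congr 1
        rw [Finset.insert_comm y a, Finset.insert_comm x a]
      rw [h1, hwz]
      by_contra h
      exact (hz _ h).2.2 x (by simp) y (by simp) hxy
  obtain ⟨v, hv, hvu⟩ := hexp j (by omega) u huc hub
  have hvx : ∀ s, v s ≠ 0 → x ∉ s ∧ y ∉ s := by
    intro s hs
    have := (hv s hs).1
    constructor
    · intro h
      have := Finset.mem_filter.1 (this h)
      exact this.2 (Or.inr hxy.symm)
    · intro h
      have := Finset.mem_filter.1 (this h)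
      exact this.2 (Or.inl hxy)
  have hcone : ∀ p, (p = x ∨ p = y) → IsCh G U (j + 1 + 1) (tcone p v) := by
    intro p hp s hs
    have hps : p ∈ s := by
      by_contra h
      simp [tcone, h] at hs
    have hs' : v (s.erase p) ≠ 0 := by simpa [tcone, hps] using hs
    obtain ⟨h1, h2, h3⟩ := hv _ hs'
    have hpU : p ∈ U := by rcases hp with rfl | rfl <;> assumption
    have hiso : ∀ b ∈ s, b ≠ p → ¬ G.Adj p b := by
      intro b hb hbp hab
      have := Finset.mem_filter.1 (h1 (Finset.mem_erase.2 ⟨hbp, hb⟩))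
      rcases hp with rfl | rfl
      · exact this.2 (Or.inl hab)
      · exact this.2 (Or.inr hab)
    refine ⟨?_, ?_, ?_⟩
    · intro a ha
      by_cases hap : a = p
      · rwa [hap]
      · exact (Finset.mem_filter.1 (h1 (Finset.mem_erase.2 ⟨hap, ha⟩))).1
    · rw [← Finset.card_erase_add_one hps, h2]
    · intro a ha b hb hab
      by_cases hap : a = p
      · subst hap
        exact hiso b hb hab.ne.symm hab
      by_cases hbp : b = p
      · subst hbp
        exact hiso a ha hap hab.symm
      exact h3 a (Finset.mem_erase.2 ⟨hap, ha⟩) b (Finset.mem_erase.2 ⟨hbp, hb⟩) hab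
  have hw0 : ∀ s, (w + tcone x (tcone y u)) s ≠ 0 → w s ≠ 0 ∧ ¬ (x ∈ s ∧ y ∈ s) := by
    intro s hs
    by_cases hb : x ∈ s ∧ y ∈ s
    · exfalso
      apply hs
      have hy' : y ∈ s.erase x := Finset.mem_erase.2 ⟨hne.symm, hb.2⟩
      simp only [Pi.add_apply, tcone, hb.1, hy', if_true, hu]
      have h1 : ¬ (x ∈ (s.erase x).erase y ∨ y ∈ (s.erase x).erase y) := by simp
      rw [if_neg h1, Finset.insert_erase hy', Finset.insert_erase hb.1]
      exact CharTwo.add_self_eq_zero _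
    · refine ⟨?_, hb⟩
      have : tcone x (tcone y u) s = 0 := by
        simp only [tcone]
        by_cases h1 : x ∈ s
        · have h2 : y ∉ s := fun h => hb ⟨h1, h⟩
          simp [h2]
        · simp [h1]
      simpa [this] using hs
  refine ⟨(w + tcone x (tcone y u)) + (tcone x v + tcone y v), ?_, ?_⟩
  · intro s hs
    by_cases h1 : (w + tcone x (tcone y u)) s = 0
    · by_cases h2 : tcone x v s = 0
      · refine hcone y (Or.inr rfl) s ?_
        intro h3
        apply hs
        rw [Pi.add_apply, h1, Pi.add_apply, h2, h3]; simp
      · exact hcone x (Or.inl rfl) s h2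
    · obtain ⟨h2, h3⟩ := hw0 s h1
      exact ⟨(hw s h2).1, (hw s h2).2.1, key s h2 h3⟩
  · rw [tbd_add, tbd_add, tbd_add, tbd_tcone, tbd_tcone, tbd_tcone, tbd_tcone, hub, hvu, hwz,
      tcone_zero, add_zero]
    have e1 := ch_add_self v
    have e2 := ch_add_self (tcone x u)
    have e3 := ch_add_self (tcone y u)
    calc z + (tcone y u + tcone x u) + (v + tcone x u + (v + tcone y u))
        = z + (v + v) + (tcone x u + tcone x u) + (tcone y u + tcone y u) := by abel
      _ = z := by rw [e1, e2, e3]; simp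

open Classical in
theorem acyc_game (G0 : SimpleGraph V) (w : V → ℕ) (M : ℕ)
    (hgame : ∀ G ≤ G0, ∀ U : Finset V, 0 < ∑ v ∈ U, w v →
      (∃ x ∈ U, ∀ y ∈ U, ¬ G.Adj x y) ∨
      ∃ x ∈ U, ∃ y ∈ U, G.Adj x y ∧
        ∑ v ∈ U.filter (fun v => G.Adj x v ∨ G.Adj y v), w v ≤ M) :
    ∀ k : ℕ, ∀ G ≤ G0, ∀ U : Finset V, M * k < ∑ v ∈ U, w v + M → Acyc G U k := by
  intro k
  induction k with
  | zero => intro G _ U _ j hj; omega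
  | succ k ihk =>
    intro G
    induction G using WellFoundedLT.induction with
    | ind G ihG =>
      intro hG U hU
      have hU' : M * k < ∑ v ∈ U, w v := by
        rw [Nat.mul_succ] at hU; omega
      rcases hgame G hG U (by omega) with ⟨x, hx, hiso⟩ | ⟨x, hx, y, hy, hxy, hM⟩
      · exact acyc_isolated G U _ x hx hiso
      · have hle : G.deleteEdges {s(x, y)} ≤ G := SimpleGraph.deleteEdges_le _
        refine acyc_explode G U k x y hx hy hxy ?_ ?_
        · refine ihG _ (lt_of_le_of_ne hle ?_) (hle.trans hG) U hU
          intro h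
          rw [← h, SimpleGraph.deleteEdges_adj] at hxy
          exact hxy.2 rfl
        · refine ihk G hG _ ?_
          have := Finset.sum_filter_add_sum_filter_not U (fun v => G.Adj x v ∨ G.Adj y v) w
          omega

end

section
set_option linter.unusedSectionVars false
variable {V A : Type*} [Fintype V] [DecidableEq A]

open Classical in
theorem hall_chain (col : V → A) (G : SimpleGraph V)
    (h : ∀ S : Finset A, Acyc G (Finset.univ.filter fun v => col v ∈ S) S.card) (m : ℕ) :
    ∃ c : Finset A → Finset V → ZMod 2, (c ∅ = fun s => if s = ∅ then 1 else 0) ∧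
      ∀ S, S.card ≤ m → IsCh G (Finset.univ.filter fun v => col v ∈ S) S.card (c S) ∧
        tbd (c S) = ∑ i ∈ S, c (S.erase i) := by
  induction m with
  | zero =>
    refine ⟨fun _ s => if s = ∅ then 1 else 0, rfl, ?_⟩
    intro S hS
    have hS' : S = ∅ := Finset.card_eq_zero.1 (by omega)
    subst hS'
    constructor
    · intro s hs
      have : s = ∅ := by
        by_contra h
        simp [h] at hs
      subst this
      simp
    · funext t
      simp [tbd]
  | succ m ih =>
    obtain ⟨c, hc0, hc⟩ := ih
    have hex : ∀ S : Finset A, S.card = m + 1 → ∃ w,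
        IsCh G (Finset.univ.filter fun v => col v ∈ S) (m + 1) w ∧
          tbd w = ∑ i ∈ S, c (S.erase i) := by
      intro S hS
      have hce : ∀ i ∈ S, (S.erase i).card = m := by
        intro i hi
        rw [Finset.card_erase_of_mem hi, hS]; rfl
      refine h S m (by omega) _ ?_ ?_
      · intro s hs
        rw [Finset.sum_apply] at hs
        obtain ⟨i, hi, hne⟩ := Finset.exists_ne_zero_of_sum_ne_zero hs
        obtain ⟨h1, h2, h3⟩ := (hc _ (hce i hi).le).1 s hne
        refine ⟨?_, by rw [h2, hce i hi], h3⟩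
        intro a ha
        have := h1 ha
        simp only [Finset.mem_filter, Finset.mem_univ, true_and, Finset.mem_erase] at this ⊢
        exact this.2
      · rw [tbd_sum, Finset.sum_congr rfl fun i hi => (hc _ (hce i hi).le).2]
        rw [Finset.sum_sigma']
        refine Finset.sum_involution (fun p _ => ⟨p.2, p.1⟩) ?_ ?_ ?_ ?_
        · rintro ⟨i, j⟩ _
          simp only
          rw [Finset.erase_right_comm, ch_add_self]
        · rintro ⟨i, j⟩ hp _ heq
          simp only [Finset.mem_sigma, Finset.mem_erase] at hp
          simp only [Sigma.mk.injEq, heq_eq_eq] at heq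
          exact hp.2.1 heq.1
        · rintro ⟨i, j⟩ hp
          simp only [Finset.mem_sigma, Finset.mem_erase] at hp ⊢
          exact ⟨hp.2.2, fun h => hp.2.1 h.symm, hp.1⟩
        · rintro ⟨i, j⟩ hp
          rfl
    choose! W hW using hex
    refine ⟨fun S => if S.card = m + 1 then W S else c S, ?_, ?_⟩
    · simp [hc0]
    · intro S hS
      have hsm : ∀ i ∈ S, ((S.erase i).card = m + 1) = False := by
        intro i hi
        have := Finset.card_erase_add_one hi
        simp only [eq_iff_iff, iff_false]
        omega
      have e : ∑ i ∈ S, (if (S.erase i).card = m + 1 then W (S.erase i) else c (S.erase i)) =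
          ∑ i ∈ S, c (S.erase i) := by
        refine Finset.sum_congr rfl fun i hi => ?_
        simp only [hsm i hi, if_false]
      rw [e]
      by_cases hSm : S.card = m + 1
      · simp only [hSm, if_true]
        exact hW S hSm
      · simp only [hSm, if_false]
        exact hc S (by omega)

open Classical in
theorem count_faces (col : V → A) (S : Finset A) (i : A) (hi : i ∈ S) (s : Finset V)
    (hcard : s.card = S.card) (hsub : s.image col ⊆ S) :
    (((s.filter fun a => (s.erase a).image col = S.erase i).card : ℕ) : ZMod 2) =
      if s.image col = S then 1 else 0 := by
  have hcS := Finset.card_erase_add_one hi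
  by_cases himg : s.image col = S
  · rw [if_pos himg]
    have hinj : Set.InjOn col s := by
      rw [← Finset.card_image_iff, himg, hcard]
    have hi' : i ∈ s.image col := by rw [himg]; exact hi
    obtain ⟨a0, ha0, hai⟩ := Finset.mem_image.1 hi'
    have : (s.filter fun a => (s.erase a).image col = S.erase i) = {a0} := by
      ext a
      simp only [Finset.mem_filter, Finset.mem_singleton]
      constructor
      · rintro ⟨ha, himg2⟩
        by_contra hne
        have : i ∈ (s.erase a).image col :=
          Finset.mem_image.2 ⟨a0, Finset.mem_erase.2 ⟨fun h => hne h.symm, ha0⟩, hai⟩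
        rw [himg2] at this
        simp at this
      · rintro rfl
        refine ⟨ha0, ?_⟩
        ext k
        simp only [Finset.mem_image, Finset.mem_erase]
        constructor
        · rintro ⟨b, ⟨hb1, hb2⟩, rfl⟩
          refine ⟨fun h => hb1 (hinj hb2 ha0 (h.trans hai.symm)), ?_⟩
          rw [← himg]
          exact Finset.mem_image_of_mem _ hb2
        · rintro ⟨hk1, hk2⟩
          rw [← himg] at hk2
          obtain ⟨b, hb, rfl⟩ := Finset.mem_image.1 hk2
          exact ⟨b, ⟨fun h => hk1 (by rw [h, hai]), hb⟩, rfl⟩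
    rw [this]
    simp
  · rw [if_neg himg]
    by_cases hemp : (s.filter fun a => (s.erase a).image col = S.erase i) = ∅
    · rw [hemp]; simp
    obtain ⟨a, ha⟩ := Finset.nonempty_iff_ne_empty.2 hemp
    rw [Finset.mem_filter] at ha
    obtain ⟨has, haimg⟩ := ha
    have hsa : s.image col = insert (col a) (S.erase i) := by
      rw [← haimg, ← Finset.image_insert, Finset.insert_erase has]
    -- injectivity of `col` after erasing
    have hinj : ∀ x ∈ s, (s.erase x).image col = S.erase i → Set.InjOn col (s.erase x) := by
      intro x hx hximg
      rw [← Finset.card_image_iff, hximg]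
      have := Finset.card_erase_add_one hx
      omega
    have hcolS : ∃ b ∈ s.erase a, col b = col a := by
      by_contra hno
      push Not at hno
      have h1 : col a ∉ S.erase i := by
        rw [← haimg]
        intro h
        obtain ⟨b, hb, hbe⟩ := Finset.mem_image.1 h
        exact hno b hb hbe
      have h2 : col a ∈ S := hsub (Finset.mem_image_of_mem _ has)
      have h3 : col a = i := by
        by_contra hne
        exact h1 (Finset.mem_erase.2 ⟨hne, h2⟩)
      apply himg
      rw [hsa, h3, Finset.insert_erase hi]
    obtain ⟨b, hb, hba⟩ := hcolS
    have hbs := Finset.mem_erase.1 hb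
    have : (s.filter fun a => (s.erase a).image col = S.erase i) = {a, b} := by
      ext x
      simp only [Finset.mem_filter, Finset.mem_insert, Finset.mem_singleton]
      constructor
      · rintro ⟨hx, hximg⟩
        by_contra hne
        push Not at hne
        exact hbs.1 (hinj x hx hximg (Finset.mem_coe.2 (Finset.mem_erase.2 ⟨hne.2.symm, hbs.2⟩))
          (Finset.mem_coe.2 (Finset.mem_erase.2 ⟨hne.1.symm, has⟩)) hba)
      · rintro (rfl | rfl)
        · exact ⟨has, haimg⟩
        · refine ⟨hbs.2, ?_⟩
          rw [← haimg]
          ext k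
          simp only [Finset.mem_image, Finset.mem_erase]
          constructor
          · rintro ⟨y, ⟨hy1, hy2⟩, rfl⟩
            by_cases hya : y = a
            · exact ⟨x, hbs, by rw [hba, hya]⟩
            · exact ⟨y, ⟨hya, hy2⟩, rfl⟩
          · rintro ⟨y, ⟨hy1, hy2⟩, rfl⟩
            by_cases hya : y = x
            · exact ⟨a, ⟨hbs.1.symm, has⟩, by rw [← hba, hya]⟩
            · exact ⟨y, ⟨hya, hy2⟩, rfl⟩
    rw [this, Finset.card_pair hbs.1.symm]
    rfl

open Classical in
theorem hall_top [Fintype A] (col : V → A) (G : SimpleGraph V)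
    (h : ∀ S : Finset A, Acyc G (Finset.univ.filter fun v => col v ∈ S) S.card) :
    ∃ s : Finset V, s.card = Fintype.card A ∧ s.image col = Finset.univ ∧
      ∀ a ∈ s, ∀ b ∈ s, ¬ G.Adj a b := by
  obtain ⟨c, hc0, hc⟩ := hall_chain col G h (Fintype.card A)
  have hc' : ∀ S, IsCh G (Finset.univ.filter fun v => col v ∈ S) S.card (c S) ∧
        tbd (c S) = ∑ i ∈ S, c (S.erase i) := fun S => hc S (Finset.card_le_univ S)
  have hN : ∀ m, ∀ S : Finset A, S.card = m →
      ∑ s ∈ Finset.univ.filter (fun s : Finset V => s.image col = S), c S s = 1 := by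
    intro m
    induction m with
    | zero =>
      intro S hS
      have hS' : S = ∅ := Finset.card_eq_zero.1 hS
      subst hS'
      rw [hc0]
      simp [Finset.image_eq_empty, Finset.filter_eq']
    | succ m ih =>
      intro S hS
      obtain ⟨i, hi⟩ : S.Nonempty := Finset.card_pos.1 (by omega)
      have h1 := ih (S.erase i) (by rw [Finset.card_erase_of_mem hi, hS]; rfl)
      have h2 : ∀ t ∈ Finset.univ.filter (fun s : Finset V => s.image col = S.erase i),
          c (S.erase i) t = tbd (c S) t := by
        intro t ht
        rw [Finset.mem_filter] at ht
        rw [(hc' S).2, Finset.sum_apply]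
        symm
        apply Finset.sum_eq_single i
        · intro j hj hji
          by_contra hne
          have h3 := ((hc' (S.erase j)).1 t hne).1
          have hj' : j ∈ t.image col := by
            rw [ht.2]; exact Finset.mem_erase.2 ⟨hji, hj⟩
          obtain ⟨b, hb, hbj⟩ := Finset.mem_image.1 hj'
          have := h3 hb
          simp [hbj] at this
        · intro h; exact absurd hi h
      rw [Finset.sum_congr rfl h2] at h1
      have h3 : ∑ t ∈ Finset.univ.filter (fun s : Finset V => s.image col = S.erase i),
          tbd (c S) t = ∑ s : Finset V, c S s *
            (((s.filter fun a => (s.erase a).image col = S.erase i).card : ℕ) : ZMod 2) := by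
        simp only [tbd]
        rw [Finset.sum_comm]
        have h4 : ∀ a : V, ∑ t ∈ Finset.univ.filter
              (fun s : Finset V => s.image col = S.erase i),
              (if a ∈ t then 0 else c S (insert a t)) =
            ∑ s : Finset V, if a ∈ s ∧ (s.erase a).image col = S.erase i then c S s else 0 := by
          intro a
          rw [← Finset.sum_filter]
          have : ∀ t : Finset V, (if a ∈ t then 0 else c S (insert a t)) =
            if a ∉ t then c S (insert a t) else 0 := by
            intro t; by_cases hat : a ∈ t <;> simp [hat]
          simp only [this]
          rw [← Finset.sum_filter, Finset.filter_filter]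
          refine Finset.sum_nbij' (fun t => insert a t) (fun s => s.erase a) ?_ ?_ ?_ ?_ ?_
          · intro t ht
            simp only [Finset.mem_filter, Finset.mem_univ, true_and] at ht ⊢
            refine ⟨Finset.mem_insert_self _ _, ?_⟩
            rw [Finset.erase_insert ht.2]; exact ht.1
          · intro s hs
            simp only [Finset.mem_filter, Finset.mem_univ, true_and] at hs ⊢
            exact ⟨hs.2, Finset.notMem_erase _ _⟩
          · intro t ht
            simp only [Finset.mem_filter, Finset.mem_univ, true_and] at ht
            exact Finset.erase_insert ht.2
          · intro s hs
            simp only [Finset.mem_filter, Finset.mem_univ, true_and] at hs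
            exact Finset.insert_erase hs.1
          · intro t ht; rfl
        rw [Finset.sum_congr rfl fun a _ => h4 a, Finset.sum_comm]
        refine Finset.sum_congr rfl fun s _ => ?_
        rw [← Finset.sum_filter, Finset.sum_const, nsmul_eq_mul, mul_comm]
        congr 3
        ext a
        simp
      rw [h3] at h1
      rw [← h1, Finset.sum_filter]
      refine Finset.sum_congr rfl fun s _ => ?_
      by_cases hz : c S s = 0
      · simp [hz]
      · have hsub : s.image col ⊆ S := by
          intro k hk
          obtain ⟨b, hb, rfl⟩ := Finset.mem_image.1 hk
          simpa using ((hc' S).1 s hz).1 hb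
        rw [count_faces col S i hi s ((hc' S).1 s hz).2.1 hsub]
        split_ifs <;> simp
  have h1 := hN _ Finset.univ rfl
  have h1' := h1.trans_ne (one_ne_zero (α := ZMod 2))
  obtain ⟨s, hs, hne⟩ := Finset.exists_ne_zero_of_sum_ne_zero h1'
  obtain ⟨-, h2, h3⟩ := (hc' Finset.univ).1 s hne
  exact ⟨s, h2, (Finset.mem_filter.1 hs).2, h3⟩

end

open Classical in
theorem integral_deg {E B C : Type*} [Fintype E] [Fintype B] [Fintype C]
    [DecidableEq B] [DecidableEq C]
    (β : E → B) (γ : E → C) (Q : Finset E) (f : E → ℝ) (hf : ∀ e, 0 ≤ f e) (K : ℕ) (T : ℝ)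
    (hB : ∀ b, ∑ e ∈ Q.filter (fun e => β e = b), f e ≤ K)
    (hC : ∀ c, ∑ e ∈ Q.filter (fun e => γ e = c), f e ≤ 2)
    (hT : T ≤ ∑ e ∈ Q, f e) :
    ∃ g : E → ℕ, (∀ e, g e ≠ 0 → e ∈ Q) ∧
      (∀ b, ∑ e ∈ Finset.univ.filter (fun e => β e = b), g e ≤ K) ∧
      (∀ c, ∑ e ∈ Finset.univ.filter (fun e => γ e = c), g e ≤ 2) ∧ T ≤ ∑ e ∈ Q, (g e : ℝ) := by
  rcases isEmpty_or_nonempty E with hE | hE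
  · refine ⟨fun _ => 0, by simp, by simp, by simp, ?_⟩
    rw [Finset.eq_empty_of_isEmpty Q] at hT ⊢
    simpa using hT
  have hfib : ∀ Y : Finset B, ∑ e ∈ Q.filter (fun e => β e ∈ Y), f e ≤ K * Y.card := by
    intro Y
    rw [← Finset.sum_fiberwise_of_maps_to (s := Q.filter (fun e => β e ∈ Y)) (t := Y) (g := β)
      (fun e he => (Finset.mem_filter.1 he).2)]
    calc _ ≤ ∑ b ∈ Y, (K : ℝ) := by
          refine Finset.sum_le_sum fun b hb => le_trans ?_ (hB b)
          refine Finset.sum_le_sum_of_subset_of_nonneg ?_ fun e _ _ => hf e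
          intro e he
          simp only [Finset.mem_filter] at he ⊢
          exact ⟨he.1.1, he.2⟩
      _ = K * Y.card := by rw [Finset.sum_const, nsmul_eq_mul, mul_comm]
  have hfibC : ∀ Y : Finset C, ∑ e ∈ Q.filter (fun e => γ e ∈ Y), f e ≤ 2 * Y.card := by
    intro Y
    rw [← Finset.sum_fiberwise_of_maps_to (s := Q.filter (fun e => γ e ∈ Y)) (t := Y) (g := γ)
      (fun e he => (Finset.mem_filter.1 he).2)]
    calc _ ≤ ∑ b ∈ Y, (2 : ℝ) := by
          refine Finset.sum_le_sum fun b hb => le_trans ?_ (hC b)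
          refine Finset.sum_le_sum_of_subset_of_nonneg ?_ fun e _ _ => hf e
          intro e he
          simp only [Finset.mem_filter] at he ⊢
          exact ⟨he.1.1, he.2⟩
      _ = 2 * Y.card := by rw [Finset.sum_const, nsmul_eq_mul, mul_comm]
  set D : ℕ := Fintype.card B * K - ⌈T⌉₊ with hD
  have hTle : ⌈T⌉₊ ≤ Fintype.card B * K := by
    rw [Nat.ceil_le]
    have := hfib Finset.univ
    simp only [Finset.mem_univ, Finset.filter_true, Finset.card_univ] at this
    push_cast
    linarith
  let t : B × Fin K → Finset ((C × Fin 2) ⊕ Fin D) := fun l =>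
    Finset.univ.filter fun r => match r with
      | Sum.inl p => ∃ e ∈ Q, β e = l.1 ∧ γ e = p.1
      | Sum.inr _ => True
  have hall : ∀ X : Finset (B × Fin K), X.card ≤ (X.biUnion t).card := by
    intro X
    rcases X.eq_empty_or_nonempty with rfl | ⟨x0, hx0⟩
    · simp
    set Y := X.image Prod.fst with hY
    set N : Finset C := (Q.filter (fun e => β e ∈ Y)).image γ with hN
    have h1 : X.card ≤ Y.card * K := by
      have : X ⊆ Y ×ˢ (Finset.univ : Finset (Fin K)) := by
        intro x hx
        rw [Finset.mem_product]
        exact ⟨Finset.mem_image_of_mem _ hx, Finset.mem_univ _⟩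
      have := Finset.card_le_card this
      simpa [Finset.card_product] using this
    have h2 : N.card * 2 + D ≤ (X.biUnion t).card := by
      have : (N ×ˢ (Finset.univ : Finset (Fin 2))).disjSum (Finset.univ : Finset (Fin D)) ⊆
          X.biUnion t := by
        intro r hr
        rw [Finset.mem_biUnion]
        rcases r with ⟨c, j⟩ | j
        · simp only [Finset.inl_mem_disjSum, Finset.mem_product, Finset.mem_univ, and_true] at hr
          obtain ⟨e, he, hec⟩ := Finset.mem_image.1 hr
          obtain ⟨heQ, heY⟩ := Finset.mem_filter.1 he
          obtain ⟨x, hx, hxe⟩ := Finset.mem_image.1 heY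
          refine ⟨x, hx, ?_⟩
          simp only [t, Finset.mem_filter, Finset.mem_univ, true_and]
          exact ⟨e, heQ, hxe.symm, hec⟩
        · exact ⟨x0, hx0, by simp [t]⟩
      have := Finset.card_le_card this
      simpa [Finset.card_disjSum, Finset.card_product] using this
    have h3 : ∑ e ∈ Q.filter (fun e => β e ∈ Y), f e ≤ 2 * N.card := by
      refine le_trans ?_ (hfibC N)
      refine Finset.sum_le_sum_of_subset_of_nonneg ?_ fun e _ _ => hf e
      intro e he
      rw [Finset.mem_filter]
      exact ⟨(Finset.mem_filter.1 he).1, Finset.mem_image_of_mem _ he⟩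
    have h4 : ∑ e ∈ Q.filter (fun e => ¬ β e ∈ Y), f e ≤ K * Yᶜ.card := by
      refine le_trans (le_of_eq ?_) (hfib Yᶜ)
      simp
    have h5 := Finset.sum_filter_add_sum_filter_not Q (fun e => β e ∈ Y) f
    have h6 : ⌈T⌉₊ ≤ 2 * N.card + K * Yᶜ.card := by
      rw [Nat.ceil_le]
      push_cast
      linarith
    have h7 : Y.card + Yᶜ.card = Fintype.card B := Finset.card_add_card_compl Y
    have h8 : Fintype.card B * K = Y.card * K + K * Yᶜ.card := by
      rw [← h7]; ring
    omega
  obtain ⟨φ, hφ, hφt⟩ := (Finset.all_card_le_biUnion_card_iff_exists_injective t).1 hall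
  set Λ : Finset (B × Fin K) := Finset.univ.filter fun l => (φ l).isLeft with hΛ
  have hex : ∀ l, l ∈ Λ → ∃ e, e ∈ Q ∧ β e = l.1 ∧ ∃ j, φ l = Sum.inl (γ e, j) := by
    intro l hl
    have hl' : (φ l).isLeft := (Finset.mem_filter.1 hl).2
    obtain ⟨⟨c, j⟩, hcj⟩ := Sum.isLeft_iff.1 hl'
    have := hφt l
    rw [hcj] at this
    simp only [t, Finset.mem_filter, Finset.mem_univ, true_and] at this
    obtain ⟨e, he, h1, h2⟩ := this
    exact ⟨e, he, h1, j, by rw [hcj, h2]⟩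
  choose! ε hε using hex
  have hΛc : ⌈T⌉₊ ≤ Λ.card := by
    have h1 : (Finset.univ.filter fun l : B × Fin K => ¬ (φ l).isLeft).card ≤ D := by
      have : ((Finset.univ.filter fun l : B × Fin K => ¬ (φ l).isLeft).image φ) ⊆
          (Finset.univ : Finset (Fin D)).image Sum.inr := by
        intro r hr
        obtain ⟨l, hl, rfl⟩ := Finset.mem_image.1 hr
        have hl' := (Finset.mem_filter.1 hl).2
        simp only [Sum.not_isLeft] at hl'
        obtain ⟨j, hj⟩ := Sum.isRight_iff.1 hl'
        rw [hj]
        exact Finset.mem_image_of_mem _ (Finset.mem_univ _)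
      have h2 := Finset.card_le_card this
      rw [Finset.card_image_of_injective _ hφ] at h2
      refine h2.trans (Finset.card_image_le.trans ?_)
      simp
    have h2 := Finset.card_filter_add_card_filter_not (s := (Finset.univ : Finset (B × Fin K)))
      (fun l => (φ l).isLeft)
    rw [Finset.card_univ, Fintype.card_prod, Fintype.card_fin] at h2
    change Λ.card + _ = _ at h2
    omega
  have hsum : ∀ P : Finset E, ∑ e ∈ P, (Λ.filter fun l => ε l = e).card =
      (Λ.filter fun l => ε l ∈ P).card := by
    intro P
    convert Finset.sum_card_fiberwise_eq_card_filter Λ P ε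
  refine ⟨fun e => (Λ.filter fun l => ε l = e).card, ?_, ?_, ?_, ?_⟩
  · intro e he
    obtain ⟨l, hl⟩ := Finset.card_pos.1 (Nat.pos_of_ne_zero he)
    obtain ⟨h1, h2⟩ := Finset.mem_filter.1 hl
    rw [← h2]; exact (hε l h1).1
  · intro b
    beta_reduce
    rw [hsum]
    have : (Λ.filter fun l => ε l ∈ Finset.univ.filter fun e => β e = b) ⊆
        ({b} : Finset B) ×ˢ (Finset.univ : Finset (Fin K)) := by
      intro l hl
      simp only [Finset.mem_filter, Finset.mem_univ, true_and] at hl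
      simp only [Finset.mem_product, Finset.mem_singleton, Finset.mem_univ, and_true]
      rw [← hl.2, (hε l hl.1).2.1]
    have := Finset.card_le_card this
    simpa [Finset.card_product] using this
  · intro c
    beta_reduce
    rw [hsum]
    have : (Λ.filter fun l => ε l ∈ Finset.univ.filter fun e => γ e = c).image φ ⊆
        (({c} : Finset C) ×ˢ (Finset.univ : Finset (Fin 2))).image Sum.inl := by
      intro r hr
      obtain ⟨l, hl, rfl⟩ := Finset.mem_image.1 hr
      simp only [Finset.mem_filter, Finset.mem_univ, true_and] at hl
      obtain ⟨j, hj⟩ := (hε l hl.1).2.2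
      rw [hj, hl.2]
      refine Finset.mem_image_of_mem _ ?_
      simp
    have h2 := Finset.card_le_card this
    rw [Finset.card_image_of_injective _ hφ] at h2
    refine h2.trans (Finset.card_image_le.trans ?_)
    simp
  · have h1 : ∑ e ∈ Q, (Λ.filter fun l => ε l = e).card = Λ.card := by
      rw [hsum]
      congr 1
      exact Finset.filter_true_of_mem fun l hl => (hε l hl).1
    rw [← Nat.cast_sum, h1]
    exact (Nat.le_ceil T).trans (by exact_mod_cast hΛc)

/-- The conflict graph. -/
def confl {V B C : Type*} (β : V → B) (γ : V → C) : SimpleGraph V where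
  Adj x y := x ≠ y ∧ (β x = β y ∨ γ x = γ y)
  symm := by
    constructor
    rintro x y ⟨h, h1⟩
    exact ⟨h.symm, h1.imp Eq.symm Eq.symm⟩
  loopless := ⟨fun x h => h.1 rfl⟩

open Classical in
theorem sum_cover {V : Type*} (w : V → ℕ) (P S1 S2 S3 : Finset V)
    (h : ∀ v ∈ P, w v ≠ 0 → v ∈ S1 ∨ v ∈ S2 ∨ v ∈ S3) :
    ∑ v ∈ P, w v ≤ ∑ v ∈ S1, w v + ∑ v ∈ S2, w v + ∑ v ∈ S3, w v := by
  have h1 : ∑ v ∈ P, w v ≤ ∑ v ∈ S1 ∪ S2 ∪ S3, w v := by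
    refine Finset.sum_le_sum_of_ne_zero fun v hv hw => ?_
    rcases h v hv hw with h | h | h <;> simp [h]
  have h2 := Finset.sum_union_inter (s₁ := S1 ∪ S2) (s₂ := S3) (f := w)
  have h3 := Finset.sum_union_inter (s₁ := S1) (s₂ := S2) (f := w)
  omega

open Classical in
theorem confl_game {V B C : Type*} {d : ℕ} [Fintype V]
    [DecidableEq B] [DecidableEq C] (β : V → B ⊕ Fin d) (γ : V → C ⊕ Fin d)
    (hβγ : ∀ v j, β v = Sum.inr j ↔ γ v = Sum.inr j) (w : V → ℕ) (K : ℕ)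
    (hB : ∀ b, ∑ v ∈ Finset.univ.filter (fun v => β v = Sum.inl b), w v ≤ K)
    (hC : ∀ c, ∑ v ∈ Finset.univ.filter (fun v => γ v = Sum.inl c), w v ≤ 2)
    (hD : ∀ j, ∑ v ∈ Finset.univ.filter (fun v => β v = Sum.inr j), w v ≤ K + 2) :
    ∀ G ≤ confl β γ, ∀ U : Finset V, 0 < ∑ v ∈ U, w v →
      (∃ x ∈ U, ∀ y ∈ U, ¬ G.Adj x y) ∨
      ∃ x ∈ U, ∃ y ∈ U, G.Adj x y ∧
        ∑ v ∈ U.filter (fun v => G.Adj x v ∨ G.Adj y v), w v ≤ K + 2 := by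
  intro G hG U hU
  have hadj : ∀ x y, G.Adj x y → β x = β y ∨ γ x = γ y := fun x y h => (hG h).2
  by_cases hiso : ∃ x ∈ U, ∀ y ∈ U, ¬ G.Adj x y
  · exact Or.inl hiso
  right
  push Not at hiso
  -- dummy vertices
  have hdum : ∀ x y j, G.Adj x y → β x = Sum.inr j → β y = Sum.inr j := by
    intro x y j h hx
    rcases hadj x y h with h1 | h1
    · rw [← h1, hx]
    · rw [hβγ, ← h1, ← hβγ, hx]
  have hdumsum : ∀ x y j, G.Adj x y → β x = Sum.inr j →
      ∑ v ∈ U.filter (fun v => G.Adj x v ∨ G.Adj y v), w v ≤ K + 2 := by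
    intro x y j h hx
    refine le_trans (Finset.sum_le_sum_of_subset ?_) (hD j)
    intro v hv
    simp only [Finset.mem_filter, Finset.mem_univ, true_and] at hv ⊢
    rcases hv.2 with h1 | h1
    · exact hdum x v j h1 hx
    · exact hdum y v j h1 (hdum x y j h hx)
  have hinl : ∀ x b, β x = Sum.inl b → ∃ c, γ x = Sum.inl c := by
    intro x b hb
    rcases hγ : γ x with c | j
    · exact ⟨c, rfl⟩
    · rw [← hβγ] at hγ
      rw [hγ] at hb
      cases hb
  by_cases h1 : ∃ x ∈ U, ∃ y ∈ U, w x ≠ 0 ∧ w y ≠ 0 ∧ G.Adj x y ∧ β x = β y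
  · obtain ⟨x, hx, y, hy, hwx, hwy, hxy, hβ⟩ := h1
    refine ⟨x, hx, y, hy, hxy, ?_⟩
    rcases hb : β x with b | j
    · obtain ⟨c1, hc1⟩ := hinl x b hb
      obtain ⟨c2, hc2⟩ := hinl y b (hβ ▸ hb)
      refine (sum_cover w _ (Finset.univ.filter (fun v => β v = Sum.inl b))
        ((Finset.univ.filter (fun v => γ v = Sum.inl c1)).erase x)
        ((Finset.univ.filter (fun v => γ v = Sum.inl c2)).erase y) ?_).trans ?_
      · intro v hv _
        simp only [Finset.mem_filter, Finset.mem_univ, true_and, Finset.mem_erase] at hv ⊢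
        rcases hv.2 with h | h
        · rcases hadj _ _ h with h2 | h2
          · left; rw [← h2, hb]
          · right; left; exact ⟨h.ne.symm, by rw [← h2, hc1]⟩
        · rcases hadj _ _ h with h2 | h2
          · left; rw [← h2, ← hβ, hb]
          · right; right; exact ⟨h.ne.symm, by rw [← h2, hc2]⟩
      · have e1 := Finset.sum_erase_add (Finset.univ.filter (fun v => γ v = Sum.inl c1)) w
          (a := x) (by simp [hc1])
        have e2 := Finset.sum_erase_add (Finset.univ.filter (fun v => γ v = Sum.inl c2)) w
          (a := y) (by simp [hc2])
        have := hB b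
        have := hC c1
        have := hC c2
        omega
    · exact hdumsum x y j hxy hb
  push Not at h1
  by_cases h2 : ∃ x ∈ U, ∃ y ∈ U, w x ≠ 0 ∧ w y ≠ 0 ∧ G.Adj x y
  · obtain ⟨x, hx, y, hy, hwx, hwy, hxy⟩ := h2
    refine ⟨x, hx, y, hy, hxy, ?_⟩
    rcases hb : β x with b | j
    · obtain ⟨c1, hc1⟩ := hinl x b hb
      have hg : γ x = γ y := (hadj x y hxy).resolve_left (h1 x hx y hy hwx hwy hxy)
      refine le_trans (Finset.sum_le_sum_of_ne_zero ?_) ((hC c1).trans (by omega))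
      intro v hv hwv
      simp only [Finset.mem_filter, Finset.mem_univ, true_and] at hv ⊢
      rcases hv.2 with h | h
      · rw [← (hadj x v h).resolve_left (h1 x hx v hv.1 hwx hwv h), hc1]
      · rw [← (hadj y v h).resolve_left (h1 y hy v hv.1 hwy hwv h), ← hg, hc1]
    · exact hdumsum x y j hxy hb
  push Not at h2
  obtain ⟨x, hx, hwx⟩ := Finset.exists_ne_zero_of_sum_ne_zero hU.ne'
  obtain ⟨y, hy, hxy⟩ := hiso x hx
  refine ⟨x, hx, y, hy, hxy, ?_⟩
  rcases hb : β y with b | j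
  · obtain ⟨c1, hc1⟩ := hinl y b hb
    refine (sum_cover w _ (Finset.univ.filter (fun v => β v = Sum.inl b))
        (Finset.univ.filter (fun v => γ v = Sum.inl c1)) ∅ ?_).trans ?_
    · intro v hv hwv
      simp only [Finset.mem_filter, Finset.mem_univ, true_and] at hv ⊢
      rcases hv.2 with h | h
      · exact absurd h (h2 x hx v hv.1 hwx hwv)
      · rcases hadj _ _ h with h3 | h3
        · left; rw [← h3, hb]
        · right; left; rw [← h3, hc1]
    · have := hB b
      have := hC c1
      rw [Finset.sum_empty]
      omega
  · exact hdumsum x y j hxy (hdum y x j hxy.symm hb)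

theorem tri_scale (n : ℕ) (hn : 1 ≤ n) (r : ℝ) (hr : 1 ≤ r)
    (c : ℕ) (hc : (c : ℝ) = r * n) (t : ℝ) (ht : 0 ≤ t)
    (H : Finset (Fin n × Fin n × Fin c)) (hH : TriFracBalanced H) :
    ∃ f : Fin n × Fin n × Fin c → ℝ, (∀ e, 0 ≤ f e) ∧ (∀ e, e ∉ H → f e = 0) ∧
      (∀ v, (∑ e, if e.1 = v then f e else 0) = t) ∧
      (∀ v, (∑ e, if e.2.1 = v then f e else 0) = t) ∧
      (∀ v, (∑ e, if e.2.2 = v then f e else 0) = t / r) := by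
  obtain ⟨f, ⟨h0, hH0, hA, hB, hC⟩, hne⟩ := hH
  set T := ∑ e, f e with hT
  have hTpos : 0 < T := by
    obtain ⟨e, he⟩ := Function.ne_iff.1 hne
    refine Finset.sum_pos' (fun e _ => h0 e) ⟨e, Finset.mem_univ _, ?_⟩
    exact lt_of_le_of_ne (h0 e) (Ne.symm he)
  have hnpos : (0 : ℝ) < n := by exact_mod_cast hn
  have gen : ∀ (m : ℕ) (p : Fin n × Fin n × Fin c → Fin m),
      (∀ v w : Fin m, (∑ e, if p e = v then f e else 0) = ∑ e, if p e = w then f e else 0) →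
      ∀ v, m * (∑ e, if p e = v then f e else 0) = T := by
    intro m p hp v
    have h1 : ∑ w : Fin m, (∑ e, if p e = w then f e else 0) = T := by
      rw [Finset.sum_comm]
      simp [hT]
    rw [Finset.sum_congr rfl fun w _ => hp w v] at h1
    simpa using h1
  have sc : ∀ (m : ℕ) (p : Fin n × Fin n × Fin c → Fin m) (v : Fin m),
      (∑ e, if p e = v then f e * (t * n / T) else 0) =
        (∑ e, if p e = v then f e else 0) * (t * n / T) := by
    intro m p v
    rw [Finset.sum_mul]
    refine Finset.sum_congr rfl fun e _ => ?_
    split_ifs <;> simp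
  refine ⟨fun e => f e * (t * n / T), ?_, ?_, ?_, ?_, ?_⟩
  · intro e
    have := h0 e
    positivity
  · intro e he
    simp [hH0 e he]
  · intro v
    have h1 := gen n (fun e => e.1) hA v
    have h2 := sc n (fun e => e.1) v
    simp only at h1 h2 ⊢
    rw [h2]
    generalize (∑ e : Fin n × Fin n × Fin c, if e.1 = v then f e else 0) = X at h1
    rw [← h1] at hTpos ⊢
    have : X ≠ 0 := by rintro rfl; simp at hTpos
    field_simp
  · intro v
    have h1 := gen n (fun e => e.2.1) hB v
    have h2 := sc n (fun e => e.2.1) v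
    simp only at h1 h2 ⊢
    rw [h2]
    generalize (∑ e : Fin n × Fin n × Fin c, if e.2.1 = v then f e else 0) = X at h1
    rw [← h1] at hTpos ⊢
    have : X ≠ 0 := by rintro rfl; simp at hTpos
    field_simp
  · intro v
    have h1 := gen c (fun e => e.2.2) hC v
    have h2 := sc c (fun e => e.2.2) v
    simp only at h1 h2 ⊢
    rw [h2]
    generalize (∑ e : Fin n × Fin n × Fin c, if e.2.2 = v then f e else 0) = X at h1
    rw [hc] at h1
    rw [← h1] at hTpos ⊢
    have : X ≠ 0 := by rintro rfl; simp at hTpos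
    have : r ≠ 0 := by positivity
    field_simp

open Classical in
theorem tri_core (n : ℕ) (hn : 1 ≤ n) (r : ℝ) (hr : 1 ≤ r)
    (c : ℕ) (hc : (c : ℝ) = r * n) (t : ℝ) (ht : 0 ≤ t) (K : ℕ) (htK : t ≤ K) (htr : t ≤ 2 * r)
    (H : Finset (Fin n × Fin n × Fin c)) (hH : TriFracBalanced H) :
    ∃ M, TriMatching H M ∧ M.card = ⌈t * n / ((K : ℝ) + 2)⌉₊ := by
  obtain ⟨f, hf0, hfH, hfA, hfB, hfC⟩ := tri_scale n hn r hr c hc t ht H hH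
  set p := ⌈t * n / ((K : ℝ) + 2)⌉₊ with hp
  have hK2 : (0 : ℝ) < (K : ℝ) + 2 := by positivity
  have hpn : p ≤ n := by
    rw [hp, Nat.ceil_le, div_le_iff₀ hK2]
    have : (0 : ℝ) ≤ n := by positivity
    nlinarith
  have hplt : (p : ℝ) < t * n / ((K : ℝ) + 2) + 1 := Nat.ceil_lt_add_one (by positivity)
  set d := n - p with hd
  let V := {e // e ∈ H} ⊕ (Fin n × Fin d)
  let col : V → Fin n := Sum.elim (fun e => e.1.1) (fun q => q.1)
  let β : V → Fin n ⊕ Fin d := Sum.map (fun e => e.1.2.1) (fun q => q.2)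
  let γ : V → Fin c ⊕ Fin d := Sum.map (fun e => e.1.2.2) (fun q => q.2)
  have hβγ : ∀ v j, β v = Sum.inr j ↔ γ v = Sum.inr j := by
    rintro (e | q) j <;> simp [β, γ]
  have hac : ∀ S : Finset (Fin n),
      Acyc (confl β γ) (Finset.univ.filter fun v => col v ∈ S) S.card := by
    intro S
    rcases S.eq_empty_or_nonempty with rfl | ⟨a0, ha0⟩
    · intro j hj; simp at hj
    -- integral weights
    let fS : {e // e ∈ H} → ℝ := fun e => f e.1
    let Q : Finset {e // e ∈ H} := Finset.univ.filter fun e => e.1.1 ∈ S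
    have tosum : ∀ (P : Fin n × Fin n × Fin c → Prop) [DecidablePred P],
        ∑ e ∈ Finset.univ.filter (fun e : {e // e ∈ H} => P e.1), fS e =
          ∑ e, if P e then f e else 0 := by
      intro P _
      rw [Finset.sum_filter]
      simp only [fS]
      have h1 : ∑ e : {e // e ∈ H}, (if P e.1 then f e.1 else 0) =
          ∑ e ∈ H, if P e then f e else 0 := Finset.sum_coe_sort H (fun e => if P e then f e else 0)
      rw [h1]
      refine Finset.sum_subset (Finset.subset_univ _) fun e _ he => ?_
      simp [hfH e he]
    have hQle : ∀ (P : Fin n × Fin n × Fin c → Prop) [DecidablePred P],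
        ∑ e ∈ Q.filter (fun e : {e // e ∈ H} => P e.1), fS e ≤ ∑ e, if P e then f e else 0 := by
      intro P _
      rw [← tosum]
      refine Finset.sum_le_sum_of_subset_of_nonneg ?_ fun e _ _ => hf0 _
      intro e he
      simp only [Finset.mem_filter, Finset.mem_univ, true_and] at he ⊢
      exact he.2
    have hQsum : t * S.card ≤ ∑ e ∈ Q, fS e := by
      have h1 : ∑ e ∈ Q, fS e = ∑ e, if e.1 ∈ S then f e else 0 := tosum (fun e => e.1 ∈ S)
      have h2 : (∑ e : Fin n × Fin n × Fin c, if e.1 ∈ S then f e else 0) =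
          ∑ v ∈ S, ∑ e, if e.1 = v then f e else 0 := by
        rw [Finset.sum_comm]
        refine Finset.sum_congr rfl fun e _ => ?_
        rw [Finset.sum_ite_eq]
      rw [h1, h2, Finset.sum_congr rfl fun v _ => hfA v, Finset.sum_const, nsmul_eq_mul, mul_comm]
    obtain ⟨g, hgQ, hgB, hgC, hgT⟩ := integral_deg (fun e : {e // e ∈ H} => e.1.2.1)
      (fun e => e.1.2.2) Q fS (fun e => hf0 _) K (t * S.card)
      (fun b => (hQle (fun e => e.2.1 = b)).trans (by rw [hfB b]; exact htK))
      (fun b => (hQle (fun e => e.2.2 = b)).trans (by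
        rw [hfC b, div_le_iff₀ (by linarith)]; exact htr)) hQsum
    let w : V → ℕ := Sum.elim g (fun q => if q.1 = a0 then K + 2 else 0)
    have hsumV : ∀ (P : V → Prop) [DecidablePred P], ∑ v ∈ Finset.univ.filter P, w v =
        ∑ e ∈ Finset.univ.filter (fun e => P (Sum.inl e)), g e +
        ∑ q ∈ Finset.univ.filter (fun q => P (Sum.inr q)), if q.1 = a0 then K + 2 else 0 := by
      intro P _
      rw [Finset.sum_filter, Finset.sum_filter, Finset.sum_filter, Fintype.sum_sum_type]
      rfl
    refine acyc_game (confl β γ) w (K + 2) ?_ S.card _ le_rfl _ ?_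
    · apply confl_game β γ hβγ w K
      · intro b
        rw [hsumV]
        have : (Finset.univ.filter fun q : Fin n × Fin d => β (Sum.inr q) = Sum.inl b) = ∅ := by
          ext q; simp [β]
        rw [this, Finset.sum_empty, add_zero]
        refine le_trans (le_of_eq ?_) (hgB b)
        refine Finset.sum_congr ?_ fun _ _ => rfl
        ext e; simp [β]
      · intro b
        rw [hsumV]
        have : (Finset.univ.filter fun q : Fin n × Fin d => γ (Sum.inr q) = Sum.inl b) = ∅ := by
          ext q; simp [γ]
        rw [this, Finset.sum_empty, add_zero]
        refine le_trans (le_of_eq ?_) (hgC b)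
        refine Finset.sum_congr ?_ fun _ _ => rfl
        ext e; simp [γ]
      · intro j
        rw [hsumV]
        have : (Finset.univ.filter fun e : {e // e ∈ H} => β (Sum.inl e) = Sum.inr j) = ∅ := by
          ext q; simp [β]
        rw [this, Finset.sum_empty, zero_add, ← Finset.sum_filter, Finset.sum_const, smul_eq_mul]
        have h1 : ((Finset.univ.filter fun q : Fin n × Fin d => β (Sum.inr q) = Sum.inr j).filter
            fun q => q.1 = a0) ⊆ {(a0, j)} := by
          rintro ⟨a, i⟩ hq
          simp only [β, Finset.mem_filter, Finset.mem_univ, true_and, Sum.map_inr,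
            Sum.inr.injEq] at hq
          simp [hq.1, hq.2]
        have h2 := Finset.card_le_card h1
        rw [Finset.card_singleton] at h2
        nlinarith
    · rw [hsumV]
      have h1 : (Finset.univ.filter fun e : {e // e ∈ H} => col (Sum.inl e) ∈ S) = Q := by
        rfl
      have h2 : d * (K + 2) ≤ ∑ q ∈ Finset.univ.filter
          (fun q : Fin n × Fin d => col (Sum.inr q) ∈ S), if q.1 = a0 then K + 2 else 0 := by
        rw [← Finset.sum_filter, Finset.sum_const, smul_eq_mul]
        refine Nat.mul_le_mul_right _ ?_
        have h3 : ({a0} : Finset (Fin n)) ×ˢ (Finset.univ : Finset (Fin d)) ⊆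
          ((Finset.univ.filter fun q : Fin n × Fin d => col (Sum.inr q) ∈ S).filter
            fun q => q.1 = a0) := by
          rintro ⟨a, i⟩ hq
          simp only [Finset.mem_product, Finset.mem_singleton, Finset.mem_univ, and_true] at hq
          subst hq
          rw [Finset.mem_filter, Finset.mem_filter]
          exact ⟨⟨Finset.mem_univ _, ha0⟩, rfl⟩
        have := Finset.card_le_card h3
        simpa [Finset.card_product] using this
      rw [h1]
      have hS : (S.card : ℝ) ≤ n := by
        have := Finset.card_le_univ S
        rw [Fintype.card_fin] at this
        exact_mod_cast this
      have hdr : (d : ℝ) = n - p := by rw [hd, Nat.cast_sub hpn]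
      have h3 : ((K : ℝ) + 2) * S.card < ∑ e ∈ Q, (g e : ℝ) + d * (K + 2) + (K + 2) := by
        refine lt_of_lt_of_le ?_ (add_le_add_left (add_le_add_left hgT _) _)
        have h4 : p * ((K : ℝ) + 2) < t * n + (K + 2) := by
          have := mul_lt_mul_of_pos_right hplt hK2
          rwa [add_mul, div_mul_cancel₀ _ hK2.ne', one_mul] at this
        rw [hdr]
        have h5 : 0 ≤ ((K : ℝ) + 2 - t) * (n - S.card) :=
          mul_nonneg (by linarith) (by linarith)
        nlinarith
      have h4 : (K + 2) * S.card < ∑ e ∈ Q, g e + d * (K + 2) + (K + 2) := by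
        exact_mod_cast h3
      omega
  obtain ⟨s, hscard, hsimg, hsind⟩ := hall_top col (confl β γ) hac
  rw [Fintype.card_fin] at hscard
  have hinj : Set.InjOn col s := by
    rw [← Finset.card_image_iff, hsimg, hscard, Finset.card_univ, Fintype.card_fin]
  have hM : ∀ e e' : {e // e ∈ H}, Sum.inl e ∈ s → Sum.inl e' ∈ s → e ≠ e' →
      e.1.1 ≠ e'.1.1 ∧ e.1.2.1 ≠ e'.1.2.1 ∧ e.1.2.2 ≠ e'.1.2.2 := by
    intro e e' he he' hne
    have hne' : (Sum.inl e : V) ≠ Sum.inl e' := fun h => hne (Sum.inl_injective h)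
    refine ⟨fun h => hne' (hinj he he' h), fun h => ?_, fun h => ?_⟩
    · exact hsind _ he _ he' ⟨hne', Or.inl (congrArg Sum.inl h)⟩
    · exact hsind _ he _ he' ⟨hne', Or.inr (congrArg Sum.inl h)⟩
  have hleft : p ≤ s.toLeft.card := by
    have h1 : s.toLeft.card + s.toRight.card = s.card := Finset.card_toLeft_add_card_toRight
    have h2 : s.toRight.card ≤ d := by
      have : s.toRight.card ≤ (Finset.univ : Finset (Fin d)).card := by
        refine Finset.card_le_card_of_injOn (fun q => q.2) (fun _ _ => Finset.mem_univ _) ?_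
        intro q hq q' hq' h
        by_contra hne
        have hne' : (Sum.inr q : V) ≠ Sum.inr q' := fun h => hne (Sum.inr_injective h)
        exact hsind _ (Finset.mem_toRight.1 hq) _ (Finset.mem_toRight.1 hq')
          ⟨hne', Or.inl (congrArg Sum.inr h)⟩
      simpa using this
    omega
  obtain ⟨L, hLs, hLc⟩ := Finset.exists_subset_card_eq hleft
  refine ⟨L.map (Function.Embedding.subtype _), ⟨?_, ?_⟩, ?_⟩
  · intro e he
    obtain ⟨e', -, rfl⟩ := Finset.mem_map.1 he
    exact e'.2
  · intro e he e' he' hne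
    obtain ⟨x, hx, rfl⟩ := Finset.mem_map.1 he
    obtain ⟨y, hy, rfl⟩ := Finset.mem_map.1 he'
    exact hM x y (Finset.mem_toLeft.1 (hLs hx)) (Finset.mem_toLeft.1 (hLs hy))
      fun h => hne (by rw [h])
  · rw [Finset.card_map, hLc]

/-- For `n ≥ 1` and real `r ≥ 1` with `rn ∈ ℕ`, every `(n,n,rn)`-fractionally
balanced tripartite hypergraph has a matching of size `⌈⌊2r⌋n/(⌊2r⌋+2)⌉` and a
matching of size `⌈2rn/(⌈2r⌉+2)⌉`. -/
theorem bm_n_n_rn (n : ℕ) (hn : 1 ≤ n) (r : ℝ) (hr : 1 ≤ r)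
    (c : ℕ) (hc : (c : ℝ) = r * n)
    (H : Finset (Fin n × Fin n × Fin c)) (hH : TriFracBalanced H) :
    (∃ M, TriMatching H M ∧
      M.card = ⌈((⌊2 * r⌋₊ * n : ℕ) : ℝ) / ((⌊2 * r⌋₊ : ℝ) + 2)⌉₊) ∧
    (∃ M, TriMatching H M ∧
      M.card = ⌈(2 * r * n) / ((⌈2 * r⌉₊ : ℝ) + 2)⌉₊) := by
  have h2r : (0 : ℝ) ≤ 2 * r := by linarith
  constructor
  · have h := tri_core n hn r hr c hc (⌊2 * r⌋₊ : ℝ) (Nat.cast_nonneg _) ⌊2 * r⌋₊ le_rfl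
      (Nat.floor_le h2r) H hH
    push_cast
    exact h
  · exact tri_core n hn r hr c hc (2 * r) h2r ⌈2 * r⌉₊ (Nat.le_ceil _) le_rfl H hH
end

section
/- Let n ≥ 2 be an even integer. Then every (n, n, n(2n−1)/2)-fractionally balanced tripartite hypergraph contains a matching of size n. -/
set_option linter.unusedSectionVars false
section tools
variable {V : Type*} [Fintype V] [LinearOrder V]

noncomputable def eps (x : V) (τ : Finset V) : ℝ := (-1) ^ (τ.filter (· < x)).card

lemma eps_sq (x : V) (τ : Finset V) : eps x τ * eps x τ = 1 := by
  unfold eps; rw [← mul_pow]; norm_num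

lemma eps_insert_self (x : V) (τ : Finset V) : eps x (insert x τ) = eps x τ := by
  unfold eps; rw [Finset.filter_insert]; simp

lemma eps_erase_self (x : V) (τ : Finset V) : eps x (τ.erase x) = eps x τ := by
  unfold eps; rw [Finset.filter_erase, Finset.erase_eq_of_notMem (by simp)]

lemma eps_insert (x y : V) (τ : Finset V) (hx : x ∉ τ) :
    eps y (insert x τ) = if x < y then - eps y τ else eps y τ := by
  unfold eps; rw [Finset.filter_insert]
  split_ifs with h
  · rw [Finset.card_insert_of_notMem (by simp [hx]), pow_succ]; ring
  · rfl

lemma eps_anti (x y : V) (τ : Finset V) (hxy : x ≠ y) (hx : x ∉ τ) (hy : y ∉ τ) :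
    eps x τ * eps y (insert x τ) = - (eps y τ * eps x (insert y τ)) := by
  rw [eps_insert x y τ hx, eps_insert y x τ hy]
  rcases lt_or_gt_of_ne hxy with h | h
  · simp [h, h.not_gt]; ring
  · simp [h, h.not_gt]; ring

lemma eps_anti_erase (x y : V) (I : Finset V) (hxy : x ≠ y) (hx : x ∈ I) (hy : y ∈ I) :
    eps x I * eps y (I.erase x) = - (eps y I * eps x (I.erase y)) := by
  have h1 : I.erase x = insert y ((I.erase x).erase y) := by
    rw [Finset.insert_erase]; simp [hy, hxy.symm]
  have h2 : I.erase y = insert x ((I.erase x).erase y) := by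
    rw [Finset.erase_right_comm, Finset.insert_erase]; simp [hx, hxy]
  have := eps_anti x y ((I.erase x).erase y) hxy (by simp) (by simp)
  have a1 : eps x I = eps x (insert y ((I.erase x).erase y)) := by rw [← h1, eps_erase_self]
  have a2 : eps y I = eps y (insert x ((I.erase x).erase y)) := by rw [← h2, eps_erase_self]
  have a3 : eps y (I.erase x) = eps y ((I.erase x).erase y) := by rw [eps_erase_self]
  have a4 : eps x (I.erase y) = eps x ((I.erase x).erase y) := by
    rw [Finset.erase_right_comm, eps_erase_self]
  rw [a1, a2, a3, a4]; linarith

/-- weighted boundary -/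
noncomputable def bd (f : V → ℝ) : (Finset V → ℝ) →ₗ[ℝ] (Finset V → ℝ) where
  toFun φ τ := ∑ x, if x ∈ τ then 0 else eps x τ * f x * φ (insert x τ)
  map_add' φ ψ := by
    funext τ
    simp only [Pi.add_apply, ← Finset.sum_add_distrib]
    refine Finset.sum_congr rfl fun x _ => ?_
    split_ifs <;> ring
  map_smul' c φ := by
    funext τ
    simp only [Pi.smul_apply, smul_eq_mul, RingHom.id_apply, Finset.mul_sum]
    refine Finset.sum_congr rfl fun x _ => ?_
    split_ifs <;> ring

lemma bd_apply (f : V → ℝ) (φ : Finset V → ℝ) (τ : Finset V) :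
    bd f φ τ = ∑ x, if x ∈ τ then 0 else eps x τ * f x * φ (insert x τ) := rfl

lemma sum_anti {ι : Type*} (s : Finset ι) (g : ι → ι → ℝ)
    (h : ∀ x ∈ s, ∀ y ∈ s, g x y = - g y x) :
    ∑ x ∈ s, ∑ y ∈ s, g x y = 0 := by
  have h1 : ∑ x ∈ s, ∑ y ∈ s, g x y = ∑ x ∈ s, ∑ y ∈ s, - g x y := by
    rw [Finset.sum_comm]
    exact Finset.sum_congr rfl fun x hx => Finset.sum_congr rfl fun y hy => h y hy x hx
  simp only [Finset.sum_neg_distrib] at h1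
  linarith

lemma bd_bd (f : V → ℝ) (φ : Finset V → ℝ) : bd f (bd f φ) = 0 := by
  funext τ
  simp only [bd_apply, Pi.zero_apply]
  have : ∀ x : V, (if x ∈ τ then (0:ℝ) else eps x τ * f x *
      ∑ y, if y ∈ insert x τ then 0 else eps y (insert x τ) * f y * φ (insert y (insert x τ))) =
      ∑ y, if x ∈ τ ∨ y ∈ τ ∨ x = y then 0 else
        eps x τ * eps y (insert x τ) * (f x * f y * φ (insert y (insert x τ))) := by
    intro x
    by_cases hx : x ∈ τ
    · simp [hx]
    · rw [if_neg hx, Finset.mul_sum]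
      refine Finset.sum_congr rfl fun y _ => ?_
      by_cases hy : y ∈ τ
      · simp [hy]
      · by_cases hxy : x = y
        · simp [hxy]
        · simp [hx, hy, hxy, Ne.symm hxy]; ring
  rw [Finset.sum_congr rfl fun x _ => this x]
  apply sum_anti
  intro x _ y _
  by_cases hx : x ∈ τ
  · simp [hx]
  by_cases hy : y ∈ τ
  · simp [hy]
  by_cases hxy : x = y
  · simp [hxy]
  simp only [hx, hy, hxy, Ne.symm hxy, or_self, if_false]
  rw [eps_anti x y τ hxy hx hy, Finset.insert_comm x y]; ring

lemma reindex (S : Finset V) (h : V → Finset V → ℝ) :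
    ∑ σ ∈ S.powerset, ∑ x ∈ σ, h x σ = ∑ τ ∈ S.powerset, ∑ x ∈ S \ τ, h x (insert x τ) := by
  rw [Finset.sum_sigma', Finset.sum_sigma']
  refine Finset.sum_bij' (fun p _ => ⟨p.1.erase p.2, p.2⟩) (fun p _ => ⟨insert p.2 p.1, p.2⟩)
    ?_ ?_ ?_ ?_ ?_
  · rintro ⟨σ, x⟩ hp
    simp only [Finset.mem_sigma, Finset.mem_powerset, Finset.mem_sdiff] at hp ⊢
    exact ⟨(Finset.erase_subset _ _).trans hp.1, hp.1 hp.2, by simp⟩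
  · rintro ⟨σ, x⟩ hp
    simp only [Finset.mem_sigma, Finset.mem_powerset, Finset.mem_sdiff] at hp ⊢
    exact ⟨Finset.insert_subset hp.2.1 hp.1, by simp⟩
  · rintro ⟨σ, x⟩ hp
    simp only [Finset.mem_sigma, Finset.mem_powerset] at hp
    simp [Finset.insert_erase hp.2]
  · rintro ⟨σ, x⟩ hp
    simp only [Finset.mem_sigma, Finset.mem_sdiff] at hp
    simp [Finset.erase_insert hp.2.2]
  · rintro ⟨σ, x⟩ hp
    simp only [Finset.mem_sigma, Finset.mem_powerset] at hp
    simp [Finset.insert_erase hp.2]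

variable {B C : Type*} [DecidableEq B] [DecidableEq C]

def Ind (β : V → B) (γ : V → C) (S : Finset V) (k : ℕ) (σ : Finset V) : Prop :=
  σ ⊆ S ∧ σ.card = k ∧ ∀ x ∈ σ, ∀ y ∈ σ, x ≠ y → β x ≠ β y ∧ γ x ≠ γ y

def KK (β : V → B) (γ : V → C) (x y : V) : ℝ :=
  (if β x = β y then 1 else 0) + (if γ x = γ y then 1 else 0)

def MM (β : V → B) (γ : V → C) (x y : V) : ℝ :=
  if β x = β y ∧ γ x = γ y then 1 else 0

noncomputable def PP (φ : Finset V → ℝ) (τ : Finset V) (y : V) : ℝ :=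
  if y ∈ τ then 0 else eps y τ * φ (insert y τ)

noncomputable def TT (β : V → B) (γ : V → C) (φ : Finset V → ℝ) (τ : Finset V) (x y : V) : ℝ :=
  (1 - KK β γ x y) * (PP φ τ y * PP φ τ x) + KK β γ x y * PP φ τ y ^ 2
    + MM β γ x y * (PP φ τ x ^ 2 - PP φ τ y ^ 2) / 2

lemma PP_erase (φ : Finset V → ℝ) (σ : Finset V) (y : V) (hy : y ∈ σ) :
    PP φ (σ.erase y) y = eps y σ * φ σ := by
  simp [PP, Finset.insert_erase hy, eps_erase_self]

lemma pointwise (β : V → B) (γ : V → C) (S : Finset V) (k : ℕ) (φ : Finset V → ℝ)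
    (hsupp : ∀ σ, φ σ ≠ 0 → Ind β γ S k σ)
    (hd : ∀ σ, Ind β γ S (k+1) σ → ∑ x ∈ σ, eps x σ * φ (σ.erase x) = 0)
    (σ : Finset V) (hσ : Ind β γ S k σ) (x : V) (hx : x ∈ S) :
    φ σ ^ 2 ≤ ∑ y ∈ σ, TT β γ φ (σ.erase y) x y := by
  by_cases hc : ∃ y ∈ σ, β x = β y ∨ γ x = γ y
  · obtain ⟨y0, hy0, hc⟩ := hc
    have h1 : ∀ y ∈ σ, 0 ≤ TT β γ φ (σ.erase y) x y ∧
        ((β x = β y ∨ γ x = γ y) → φ σ ^ 2 ≤ TT β γ φ (σ.erase y) x y) := by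
      intro y hy
      have hp : PP φ (σ.erase y) y ^ 2 = φ σ ^ 2 := by
        rw [PP_erase φ σ y hy, mul_pow, pow_two (eps y σ), eps_sq, one_mul]
      set p := PP φ (σ.erase y) y with hpdef
      unfold TT
      rw [← hpdef]
      set q := PP φ (σ.erase y) x with hq
      have : (β x = β y ∨ γ x = γ y) → φ σ ^ 2 ≤ (1 - KK β γ x y) * (p * q) + KK β γ x y * p ^ 2
          + MM β γ x y * (q ^ 2 - p ^ 2) / 2 := by
        intro h
        unfold KK MM
        by_cases h1 : β x = β y <;> by_cases h2 : γ x = γ y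
        · simp [h1, h2]; nlinarith [sq_nonneg (p - q)]
        · simp [h1, h2]; nlinarith
        · simp [h1, h2]; nlinarith
        · tauto
      refine ⟨?_, this⟩
      by_cases h : β x = β y ∨ γ x = γ y
      · exact (sq_nonneg _).trans (this h)
      · have hq0 : q = 0 := by
          rw [hq]; unfold PP
          split_ifs with hm
          · rfl
          · by_contra hne
            have hne' : φ (insert x (σ.erase y)) ≠ 0 := fun h0 => hne (by rw [h0, mul_zero])
            have hi := (hsupp _ hne').2.2 x (by simp) y0
              (by simp only [Finset.mem_insert, Finset.mem_erase]; right
                  exact ⟨fun h' => h (h' ▸ hc), hy0⟩)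
              (fun h' => hm (by
                rw [h']; simp only [Finset.mem_erase]
                exact ⟨fun h'' => h (h'' ▸ hc), hy0⟩))
            tauto
        push Not at h
        simp [KK, MM, h.1, h.2, hq0]
    calc φ σ ^ 2 ≤ TT β γ φ (σ.erase y0) x y0 := (h1 y0 hy0).2 hc
      _ ≤ _ := Finset.single_le_sum (f := fun y => TT β γ φ (σ.erase y) x y)
        (fun y hy => (h1 y hy).1) hy0
  · push Not at hc
    have hxσ : x ∉ σ := fun h => (hc x h).1 rfl
    have hI : Ind β γ S (k+1) (insert x σ) := by
      refine ⟨Finset.insert_subset hx hσ.1, by rw [Finset.card_insert_of_notMem hxσ, hσ.2.1], ?_⟩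
      intro a ha b hb hab
      rw [Finset.mem_insert] at ha hb
      rcases ha with rfl | ha <;> rcases hb with rfl | hb
      · exact absurd rfl hab
      · exact hc b hb
      · exact ⟨(hc a ha).1.symm, (hc a ha).2.symm⟩
      · exact hσ.2.2 a ha b hb hab
    have h := hd _ hI
    rw [Finset.sum_insert hxσ, Finset.erase_insert hxσ, eps_insert_self] at h
    have e : ∑ y ∈ σ, TT β γ φ (σ.erase y) x y =
        - ((eps x σ * φ σ) * ∑ y ∈ σ, eps y (insert x σ) * φ ((insert x σ).erase y)) := by
      rw [Finset.mul_sum, ← Finset.sum_neg_distrib]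
      refine Finset.sum_congr rfl fun y hy => ?_
      have hxy : x ≠ y := fun h => hxσ (h ▸ hy)
      have hK : KK β γ x y = 0 := by simp [KK, hc y hy]
      have hM : MM β γ x y = 0 := by simp [MM, hc y hy]
      unfold TT
      rw [hK, hM, PP_erase φ σ y hy]
      have hxe : x ∉ σ.erase y := fun h => hxσ (Finset.mem_of_mem_erase h)
      have e1 : (insert x σ).erase y = insert x (σ.erase y) := by
        rw [Finset.erase_insert_of_ne hxy]
      have e2 := eps_anti x y (σ.erase y) hxy hxe (by simp)
      rw [Finset.insert_erase hy, eps_erase_self, ← e1, eps_erase_self] at e2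
      have s1 := eps_sq x σ
      have s2 := eps_sq x (σ.erase y)
      have s3 := eps_sq y σ
      unfold PP
      rw [if_neg hxe, e1]
      -- eps y σ * eps x (erase) = - eps x σ * eps y (insert)
      have e3 : eps y σ * eps x (σ.erase y) = - (eps x σ * eps y (insert x σ)) := by
        have := e2
        have h4 : eps x (σ.erase y) * eps y (insert x σ) * (eps x (σ.erase y) * eps x σ)
          = -(eps y σ * eps x σ) * (eps x (σ.erase y) * eps x σ) := by rw [this]
        have h5 : eps x σ * eps y (insert x σ) = - (eps y σ * eps x (σ.erase y)) := by
          linear_combination h4 - eps x σ * eps y (insert x σ) * s2 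
            - eps y σ * eps x (σ.erase y) * s1
        rw [h5]; ring
      linear_combination φ σ * φ (insert x (σ.erase y)) * e3
    rw [e]
    have h' : ∑ y ∈ σ, eps y (insert x σ) * φ ((insert x σ).erase y) = - (eps x σ * φ σ) := by
      linarith
    rw [h']
    have s1 := eps_sq x σ
    nlinarith [s1]

lemma quad_nonneg {D : Type*} [DecidableEq D] (β : V → D) (S : Finset V) (g : V → ℝ) :
    0 ≤ ∑ y ∈ S, ∑ x ∈ S, (if β x = β y then (1:ℝ) else 0) * (g y * g x) := by
  have : ∑ y ∈ S, ∑ x ∈ S, (if β x = β y then (1:ℝ) else 0) * (g y * g x) =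
      ∑ b ∈ S.image β, (∑ x ∈ S, if β x = b then g x else 0) ^ 2 := by
    simp only [pow_two, Finset.sum_mul_sum]
    rw [Finset.sum_comm' (t' := S) (s' := fun _ => S.image β) (by simp)]
    refine Finset.sum_congr rfl fun y hy => ?_
    rw [Finset.sum_comm]
    refine Finset.sum_congr rfl fun x hx => ?_
    rw [Finset.sum_eq_single (β y)]
    · by_cases h : β x = β y <;> simp [h]
    · intro b _ hb
      simp [Ne.symm hb]
    · intro h; exact absurd (Finset.mem_image_of_mem _ hy) h
  rw [this]
  exact Finset.sum_nonneg fun _ _ => sq_nonneg _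

lemma harmonic_vanishing (β : V → B) (γ : V → C) (f : V → ℝ) (hf : ∀ x, 0 < f x) (S : Finset V) (k : ℕ)
    (lam : ℝ) (hl : ∀ y, ∑ x ∈ S, f x * KK β γ x y ≤ lam) (hF : k * lam < ∑ x ∈ S, f x)
    (φ : Finset V → ℝ)
    (hsupp : ∀ σ, φ σ ≠ 0 → Ind β γ S k σ) (hbd : bd f φ = 0)
    (hd : ∀ σ, Ind β γ S (k+1) σ → ∑ x ∈ σ, eps x σ * φ (σ.erase x) = 0) : φ = 0 := by
  set w : Finset V → ℝ := fun σ => ∏ x ∈ σ, f x with hw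
  have hwpos : ∀ σ, 0 < w σ := fun σ => Finset.prod_pos fun x _ => hf x
  set N : ℝ := ∑ σ ∈ S.powerset, w σ * φ σ ^ 2 with hN
  have key : ∀ τ, ∑ y ∈ S, ∑ x ∈ S, f y * f x * TT β γ φ τ x y ≤
      lam * ∑ y ∈ S, f y * PP φ τ y ^ 2 := by
    intro τ
    have h0 : ∑ x ∈ S, f x * PP φ τ x = 0 := by
      have := congrFun hbd τ
      rw [bd_apply, Pi.zero_apply] at this
      rw [← this]
      rw [← Finset.sum_subset (Finset.subset_univ S)]
      · refine Finset.sum_congr rfl fun x _ => ?_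
        unfold PP; split_ifs <;> ring
      · intro x _ hx
        split_ifs with h
        · rfl
        · have : φ (insert x τ) = 0 := by
            by_contra hne
            exact hx ((hsupp _ hne).1 (by simp))
          rw [this, mul_zero]
    have e : ∑ y ∈ S, ∑ x ∈ S, f y * f x * TT β γ φ τ x y =
        (∑ x ∈ S, f x * PP φ τ x) * (∑ x ∈ S, f x * PP φ τ x)
        - ∑ y ∈ S, ∑ x ∈ S, (if β x = β y then (1:ℝ) else 0) * ((f y * PP φ τ y) * (f x * PP φ τ x))
        - ∑ y ∈ S, ∑ x ∈ S, (if γ x = γ y then (1:ℝ) else 0) * ((f y * PP φ τ y) * (f x * PP φ τ x))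
        + ∑ y ∈ S, (f y * PP φ τ y ^ 2) * ∑ x ∈ S, f x * KK β γ x y
        + ∑ y ∈ S, ∑ x ∈ S, f y * f x * (MM β γ x y * (PP φ τ x ^ 2 - PP φ τ y ^ 2) / 2) := by
      rw [Finset.sum_mul_sum]
      simp only [Finset.mul_sum, ← Finset.sum_sub_distrib,
        ← Finset.sum_add_distrib]
      refine Finset.sum_congr rfl fun y _ => Finset.sum_congr rfl fun x _ => ?_
      unfold TT KK; ring
    have hM : ∑ y ∈ S, ∑ x ∈ S, f y * f x * (MM β γ x y * (PP φ τ x ^ 2 - PP φ τ y ^ 2) / 2) = 0 := by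
      apply sum_anti
      intro x _ y _
      have : MM β γ x y = MM β γ y x := by simp only [MM, eq_comm]
      rw [this]; ring
    have hK : ∑ y ∈ S, (f y * PP φ τ y ^ 2) * ∑ x ∈ S, f x * KK β γ x y ≤
        lam * ∑ y ∈ S, f y * PP φ τ y ^ 2 := by
      rw [Finset.mul_sum]
      refine Finset.sum_le_sum fun y _ => ?_
      rw [mul_comm lam]
      exact mul_le_mul_of_nonneg_left (hl y) (mul_nonneg (hf y).le (sq_nonneg _))
    have q1 := quad_nonneg β S (fun x => f x * PP φ τ x)
    have q2 := quad_nonneg γ S (fun x => f x * PP φ τ x)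
    rw [e, h0, hM]
    linarith
  have step1 : (∑ x ∈ S, f x) * N ≤
      ∑ σ ∈ S.powerset, ∑ y ∈ σ, w σ * ∑ x ∈ S, f x * TT β γ φ (σ.erase y) x y := by
    rw [hN, Finset.mul_sum]
    refine Finset.sum_le_sum fun σ _ => ?_
    by_cases h : Ind β γ S k σ
    · rw [← Finset.mul_sum, Finset.sum_comm, mul_left_comm, Finset.sum_mul]
      refine mul_le_mul_of_nonneg_left ?_ (hwpos σ).le
      refine Finset.sum_le_sum fun x hx => ?_
      rw [← Finset.mul_sum]
      exact mul_le_mul_of_nonneg_left (pointwise β γ S k φ hsupp hd σ h x hx) (hf x).le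
    · have h0 : φ σ = 0 := by by_contra hne; exact h (hsupp _ hne)
      rw [h0]; simp only [ne_eq, OfNat.ofNat_ne_zero, not_false_eq_true, zero_pow, mul_zero]
      refine Finset.sum_nonneg fun y hy => mul_nonneg (hwpos σ).le
        (Finset.sum_nonneg fun x _ => mul_nonneg (hf x).le ?_)
      unfold TT
      rw [PP_erase φ σ y hy, h0]
      have : 0 ≤ MM β γ x y := by unfold MM; split_ifs <;> norm_num
      have := mul_nonneg this (sq_nonneg (PP φ (σ.erase y) x))
      simp; linarith
  have step2 : ∑ σ ∈ S.powerset, ∑ y ∈ σ, w σ * ∑ x ∈ S, f x * TT β γ φ (σ.erase y) x y ≤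
      ∑ τ ∈ S.powerset, w τ * (lam * ∑ y ∈ S, f y * PP φ τ y ^ 2) := by
    rw [reindex S (fun y σ => w σ * ∑ x ∈ S, f x * TT β γ φ (σ.erase y) x y)]
    refine Finset.sum_le_sum fun τ _ => ?_
    refine le_trans ?_ (mul_le_mul_of_nonneg_left (key τ) (hwpos τ).le)
    rw [Finset.mul_sum]
    have e1 : ∀ y ∈ S \ τ, w (insert y τ) * ∑ x ∈ S, f x * TT β γ φ ((insert y τ).erase y) x y
        = w τ * ∑ x ∈ S, f y * f x * TT β γ φ τ x y := by
      intro y hy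
      have hy' := (Finset.mem_sdiff.1 hy).2
      rw [Finset.erase_insert hy', hw]
      simp only [Finset.prod_insert hy', Finset.mul_sum]
      refine Finset.sum_congr rfl fun x _ => ?_
      ring
    rw [Finset.sum_congr rfl e1]
    refine Finset.sum_le_sum_of_subset_of_nonneg Finset.sdiff_subset ?_
    intro y hyS hy
    have hyτ : y ∈ τ := by by_contra h; exact hy (Finset.mem_sdiff.2 ⟨hyS, h⟩)
    refine mul_nonneg (hwpos τ).le (Finset.sum_nonneg fun x _ =>
      mul_nonneg (mul_nonneg (hf y).le (hf x).le) ?_)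
    have hp : PP φ τ y = 0 := by simp [PP, hyτ]
    unfold TT
    rw [hp]
    have : 0 ≤ MM β γ x y := by unfold MM; split_ifs <;> norm_num
    have := mul_nonneg this (sq_nonneg (PP φ τ x))
    simp; linarith
  have step3 : ∑ τ ∈ S.powerset, w τ * (lam * ∑ y ∈ S, f y * PP φ τ y ^ 2) = k * lam * N := by
    have e0 : ∀ τ, w τ * (lam * ∑ y ∈ S, f y * PP φ τ y ^ 2) =
        ∑ y ∈ S \ τ, lam * (w (insert y τ) * φ (insert y τ) ^ 2) := by
      intro τ
      rw [← Finset.sum_subset (Finset.sdiff_subset : S \ τ ⊆ S), Finset.mul_sum, Finset.mul_sum]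
      · refine Finset.sum_congr rfl fun y hy => ?_
        have hy' := (Finset.mem_sdiff.1 hy).2
        simp only [hw, Finset.prod_insert hy', PP, if_neg hy', mul_pow]
        have := eps_sq y τ
        rw [pow_two (eps y τ), this]; ring
      · intro y hyS hy
        have hyτ : y ∈ τ := by by_contra h; exact hy (Finset.mem_sdiff.2 ⟨hyS, h⟩)
        simp [PP, hyτ]
    rw [Finset.sum_congr rfl fun τ _ => e0 τ, ← reindex S (fun _ σ => lam * (w σ * φ σ ^ 2)), hN,
      Finset.mul_sum]
    refine Finset.sum_congr rfl fun σ _ => ?_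
    rw [Finset.sum_const, nsmul_eq_mul]
    by_cases h0 : φ σ = 0
    · simp [h0]
    · rw [(hsupp σ h0).2.1]; ring
  have hN0 : 0 ≤ N := Finset.sum_nonneg fun σ _ => mul_nonneg (hwpos σ).le (sq_nonneg _)
  have hN1 : N = 0 := by
    by_contra hne
    have : 0 < N := lt_of_le_of_ne hN0 (Ne.symm hne)
    nlinarith [step1.trans (step2.trans step3.le)]
  funext σ
  by_contra hne
  have hσ := (hsupp σ hne).1
  have := (Finset.sum_eq_zero_iff_of_nonneg
    (fun σ _ => mul_nonneg (hwpos σ).le (sq_nonneg _))).1 hN1 σ (Finset.mem_powerset.2 hσ)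
  rcases mul_eq_zero.1 this with h | h
  · exact (hwpos σ).ne' h
  · exact hne (by simpa using h)

open Classical in
/-- coboundary -/
noncomputable def cobd (P : Finset V → Prop) : (Finset V → ℝ) →ₗ[ℝ] (Finset V → ℝ) where
  toFun φ σ := if P σ then ∑ x ∈ σ, eps x σ * φ (σ.erase x) else 0
  map_add' φ ψ := by
    funext σ
    simp only [Pi.add_apply]
    split_ifs
    · rw [← Finset.sum_add_distrib]
      exact Finset.sum_congr rfl fun x _ => by ring
    · simp
  map_smul' c φ := by
    funext σ
    simp only [Pi.smul_apply, smul_eq_mul, RingHom.id_apply]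
    split_ifs
    · rw [Finset.mul_sum]
      exact Finset.sum_congr rfl fun x _ => by ring
    · simp

open Classical in
lemma cobd_apply (P : Finset V → Prop) (φ : Finset V → ℝ) (σ : Finset V) :
    cobd P φ σ = if P σ then ∑ x ∈ σ, eps x σ * φ (σ.erase x) else 0 := rfl

lemma bd_supp (β : V → B) (γ : V → C) (f : V → ℝ) (S : Finset V) (k : ℕ) (ψ : Finset V → ℝ)
    (h : ∀ σ, ψ σ ≠ 0 → Ind β γ S (k+1) σ) (τ : Finset V) (hτ : bd f ψ τ ≠ 0) :
    Ind β γ S k τ := by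
  rw [bd_apply] at hτ
  obtain ⟨x, _, hx⟩ := Finset.exists_ne_zero_of_sum_ne_zero hτ
  by_cases hm : x ∈ τ
  · simp [hm] at hx
  rw [if_neg hm] at hx
  obtain ⟨h1, h2, h3⟩ := h _ (right_ne_zero_of_mul hx)
  rw [Finset.card_insert_of_notMem hm] at h2
  exact ⟨fun y hy => h1 (Finset.mem_insert_of_mem hy), by omega, fun a ha b hb =>
    h3 a (Finset.mem_insert_of_mem ha) b (Finset.mem_insert_of_mem hb)⟩

lemma exact_at (β : V → B) (γ : V → C) (f : V → ℝ) (hf : ∀ x, 0 < f x) (S : Finset V) (k : ℕ)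
    (lam : ℝ) (hl : ∀ y, ∑ x ∈ S, f x * KK β γ x y ≤ lam) (hF : k * lam < ∑ x ∈ S, f x)
    (φ : Finset V → ℝ)
    (hsupp : ∀ σ, φ σ ≠ 0 → Ind β γ S k σ) (hbd : bd f φ = 0) :
    ∃ ψ : Finset V → ℝ, (∀ σ, ψ σ ≠ 0 → Ind β γ S (k+1) σ) ∧ bd f ψ = φ := by
  classical
  set d := cobd (Ind β γ S (k+1)) with hdd
  have hds : ∀ φ σ, d φ σ ≠ 0 → Ind β γ S (k+1) σ := by
    intro φ σ h
    rw [hdd, cobd_apply] at h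
    by_contra hn
    simp [hn] at h
  let Z : Submodule ℝ (Finset V → ℝ) :=
    { carrier := {φ | (∀ σ, ¬ Ind β γ S k σ → φ σ = 0) ∧ bd f φ = 0}
      add_mem' := by
        rintro a b ⟨ha, ha'⟩ ⟨hb, hb'⟩
        exact ⟨fun σ h => by simp [ha σ h, hb σ h], by rw [map_add, ha', hb', add_zero]⟩
      zero_mem' := ⟨fun _ _ => rfl, map_zero _⟩
      smul_mem' := by
        rintro c a ⟨ha, ha'⟩
        exact ⟨fun σ h => by simp [ha σ h], by rw [map_smul, ha', smul_zero]⟩ }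
  have hZ : ∀ z ∈ Z, ((bd f).comp d) z ∈ Z := by
    intro z _
    refine ⟨fun σ h => ?_, bd_bd f _⟩
    by_contra hne
    exact h (bd_supp β γ f S k _ (hds z) σ hne)
  let L := ((bd f).comp d).restrict hZ
  have hinj : Function.Injective L := by
    rw [← LinearMap.ker_eq_bot, LinearMap.ker_eq_bot']
    rintro ⟨z, hz1, hz2⟩ hL
    have hL' : bd f (d z) = 0 := congrArg Subtype.val hL
    have hsz : ∀ σ, z σ ≠ 0 → Ind β γ S k σ := fun σ h => by
      by_contra hn; exact h (hz1 σ hn)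
    have e : ∑ σ ∈ (Finset.univ : Finset V).powerset, (∏ x ∈ σ, f x) * d z σ ^ 2 = 0 := by
      have e1 : ∀ σ, (∏ x ∈ σ, f x) * d z σ ^ 2 =
          ∑ x ∈ σ, (∏ x ∈ σ, f x) * d z σ * (eps x σ * z (σ.erase x)) := by
        intro σ
        rw [← Finset.mul_sum]
        by_cases h : Ind β γ S (k+1) σ
        · have : d z σ = ∑ x ∈ σ, eps x σ * z (σ.erase x) := by rw [hdd, cobd_apply, if_pos h]
          rw [← this]; ring
        · have : d z σ = 0 := by rw [hdd, cobd_apply, if_neg h]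
          rw [this]; ring
      rw [Finset.sum_congr rfl fun σ _ => e1 σ,
        reindex Finset.univ (fun x σ => (∏ x ∈ σ, f x) * d z σ * (eps x σ * z (σ.erase x)))]
      refine Finset.sum_eq_zero fun τ _ => ?_
      have h2 := congrFun hL' τ
      rw [bd_apply, Pi.zero_apply] at h2
      have h3 : ∑ x ∈ Finset.univ \ τ, eps x τ * f x * d z (insert x τ) = 0 := by
        rw [← h2, ← Finset.sum_subset (Finset.subset_univ (Finset.univ \ τ))]
        · refine Finset.sum_congr rfl fun x hx => ?_
          rw [if_neg (Finset.mem_sdiff.1 hx).2]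
        · intro x _ hx
          rw [if_pos (by simpa using hx)]
      have : (∏ x ∈ τ, f x) * z τ * ∑ x ∈ Finset.univ \ τ, eps x τ * f x * d z (insert x τ) = 0 := by
        rw [h3, mul_zero]
      rw [← this, Finset.mul_sum]
      refine Finset.sum_congr rfl fun x hx => ?_
      have hx' := (Finset.mem_sdiff.1 hx).2
      rw [Finset.prod_insert hx', Finset.erase_insert hx', eps_insert_self]; ring
    have hdz : ∀ σ, d z σ = 0 := by
      intro σ
      have hp : ∀ σ : Finset V, 0 < ∏ x ∈ σ, f x := fun σ => Finset.prod_pos fun x _ => hf x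
      have := (Finset.sum_eq_zero_iff_of_nonneg
        (fun σ _ => mul_nonneg (hp σ).le (sq_nonneg _))).1 e σ (by simp)
      rcases mul_eq_zero.1 this with h | h
      · exact absurd h (hp σ).ne'
      · simpa using h
    have := harmonic_vanishing β γ f hf S k lam hl hF z hsz hz2 (fun σ h => by
      have := hdz σ
      rwa [hdd, cobd_apply, if_pos h] at this)
    exact Subtype.ext this
  have hsurj := LinearMap.injective_iff_surjective.1 hinj
  obtain ⟨z, hz⟩ := hsurj ⟨φ, fun σ h => by by_contra hn; exact h (hsupp σ hn), hbd⟩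
  exact ⟨d z, hds _, congrArg Subtype.val hz⟩

variable {n : ℕ}

def rowSet (row : V → Fin n) (I : Finset (Fin n)) : Finset V :=
  Finset.univ.filter (fun v => row v ∈ I)

def GoodChain (β : V → B) (γ : V → C) (f : V → ℝ) (row : V → Fin n)
    (c : Finset (Fin n) → Finset V → ℝ) (I : Finset (Fin n)) : Prop :=
  (∀ σ, c I σ ≠ 0 → Ind β γ (rowSet row I) I.card σ) ∧
    bd f (c I) = ∑ i ∈ I, eps i I • c (I.erase i)

lemma chain_exists (β : V → B) (γ : V → C) (f : V → ℝ) (hf : ∀ x, 0 < f x) (row : V → Fin n)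
    (lam : ℝ) (hl : ∀ y, ∑ x, f x * KK β γ x y ≤ lam)
    (hF : ∀ (I : Finset (Fin n)) (k : ℕ), I.card = k + 1 →
      k * lam < ∑ x ∈ rowSet row I, f x) (m : ℕ) :
    ∃ c : Finset (Fin n) → Finset V → ℝ, c ∅ ∅ = 1 ∧
      ∀ I, I.card ≤ m → GoodChain β γ f row c I := by
  induction m with
  | zero =>
    refine ⟨fun _ σ => if σ = ∅ then 1 else 0, by simp, ?_⟩
    intro I hI
    have hI : I = ∅ := by simpa using hI
    subst hI
    refine ⟨?_, ?_⟩
    · intro σ h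
      have : σ = ∅ := by by_contra hn; simp [hn] at h
      subst this
      exact ⟨by simp, by simp, by simp⟩
    · funext τ
      simp [bd_apply]
  | succ m ih =>
    obtain ⟨c, hc0, hc⟩ := ih
    have hex : ∀ I : Finset (Fin n), ∃ ψ : Finset V → ℝ, I.card = m + 1 →
        (∀ σ, ψ σ ≠ 0 → Ind β γ (rowSet row I) (m+1) σ) ∧
        bd f ψ = ∑ i ∈ I, eps i I • c (I.erase i) := by
      intro I
      by_cases hI : I.card = m + 1
      swap
      · exact ⟨0, fun h => absurd h hI⟩
      have hlS : ∀ y, ∑ x ∈ rowSet row I, f x * KK β γ x y ≤ lam := fun y =>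
        (Finset.sum_le_sum_of_subset_of_nonneg (Finset.subset_univ _) (fun x _ _ =>
          mul_nonneg (hf x).le (by unfold KK; positivity))).trans (hl y)
      have hcard : ∀ i ∈ I, (I.erase i).card = m := fun i hi => by
        rw [Finset.card_erase_of_mem hi, hI]; rfl
      obtain ⟨ψ, h1, h2⟩ := exact_at β γ f hf (rowSet row I) m lam hlS (hF I m hI)
        (∑ i ∈ I, eps i I • c (I.erase i)) (by
          intro σ h
          rw [Finset.sum_apply] at h
          obtain ⟨i, hi, hne⟩ := Finset.exists_ne_zero_of_sum_ne_zero h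
          rw [Pi.smul_apply, smul_eq_mul] at hne
          obtain ⟨a1, a2, a3⟩ := (hc (I.erase i) (hcard i hi).le).1 σ (right_ne_zero_of_mul hne)
          refine ⟨a1.trans ?_, by rw [a2, hcard i hi], a3⟩
          intro v hv
          simp only [rowSet, Finset.mem_filter, Finset.mem_univ, true_and] at hv ⊢
          exact Finset.mem_of_mem_erase hv) (by
          rw [map_sum]
          have : ∀ i ∈ I, bd f (eps i I • c (I.erase i)) = ∑ j ∈ I,
              if i = j then 0 else (eps i I * eps j (I.erase i)) • c ((I.erase i).erase j) := by
            intro i hi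
            rw [map_smul, (hc (I.erase i) (hcard i hi).le).2, Finset.smul_sum,
              ← Finset.sum_subset (Finset.erase_subset i I)]
            · refine Finset.sum_congr rfl fun j hj => ?_
              rw [if_neg (Finset.ne_of_mem_erase hj).symm, smul_smul]
            · intro j hj hj'
              rw [if_pos]
              by_contra hne
              exact hj' (Finset.mem_erase.2 ⟨fun h => hne h.symm, hj⟩)
          rw [Finset.sum_congr rfl this]
          funext τ
          simp only [Finset.sum_apply, Pi.zero_apply]
          apply sum_anti
          intro i hi j hj
          by_cases hij : i = j
          · simp [hij]
          · rw [if_neg hij, if_neg (Ne.symm hij), eps_anti_erase i j I hij hi hj,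
              Finset.erase_right_comm]
            simp)
      exact ⟨ψ, fun _ => ⟨h1, h2⟩⟩
    choose ψ hψ using hex
    refine ⟨fun I => if I.card = m + 1 then ψ I else c I, by simpa using hc0, ?_⟩
    intro I hI
    have hsmall : ∀ J : Finset (Fin n), J.card ≤ m → ¬ (J.card = m + 1) := fun J h => by omega
    have hsum : ∑ i ∈ I, eps i I • (fun I => if I.card = m + 1 then ψ I else c I) (I.erase i) =
        ∑ i ∈ I, eps i I • c (I.erase i) := by
      refine Finset.sum_congr rfl fun i hi => ?_
      have := Finset.card_erase_of_mem hi
      have : ¬ ((I.erase i).card = m + 1) := by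
        have := Finset.card_pos.2 ⟨i, hi⟩; omega
      simp only [if_neg this]
    unfold GoodChain
    rw [hsum]
    by_cases h : I.card = m + 1
    · simp only [if_pos h]
      rw [h]
      exact hψ I h
    · simp only [if_neg h]
      exact hc I (by omega)

/-- rainbow sets -/
def RB (row : V → Fin n) (I : Finset (Fin n)) (σ : Finset V) : Prop :=
  σ.image row = I ∧ σ.card = I.card

lemma RB.inj {row : V → Fin n} {I : Finset (Fin n)} {σ : Finset V} (h : RB row I σ) :
    ∀ x ∈ σ, ∀ y ∈ σ, row x = row y → x = y := by
  have := Finset.card_image_iff.1 (by rw [h.1, h.2] : (σ.image row).card = σ.card)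
  intro x hx y hy hxy
  exact this hx hy hxy

open Classical in
lemma Qsum (row : V → Fin n) (hrow : ∀ x y, row x < row y → x < y) (I : Finset (Fin n)) (m : Fin n)
    (hm : m ∈ I) (hmin : ∀ i ∈ I, m ≤ i) (σ : Finset V) (hσ : σ ⊆ rowSet row I)
    (hcard : σ.card = I.card) :
    ∑ x ∈ σ, (if RB row (I.erase m) (σ.erase x) then eps x σ else 0) =
      if RB row I σ then 1 else 0 := by
  have hmem : ∀ x ∈ σ, row x ∈ I := fun x hx => by
    have := hσ hx; simpa [rowSet] using this
  by_cases hR : RB row I σ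
  · rw [if_pos hR]
    have : m ∈ σ.image row := by rw [hR.1]; exact hm
    obtain ⟨x0, hx0, hx0m⟩ := Finset.mem_image.1 this
    rw [Finset.sum_eq_single x0]
    · rw [if_pos]
      · unfold eps
        rw [Finset.filter_false_of_mem]
        · simp
        · intro y hy hlt
          have h1 : row x0 ≤ row y := by rw [hx0m]; exact hmin _ (hmem y hy)
          rcases h1.lt_or_eq with h | h
          · exact lt_asymm hlt (hrow _ _ h)
          · rw [hR.inj _ hx0 _ hy h] at hlt; exact lt_irrefl _ hlt
      · refine ⟨?_, ?_⟩
        · ext i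
          simp only [Finset.mem_image, Finset.mem_erase]
          constructor
          · rintro ⟨y, ⟨hy1, hy2⟩, rfl⟩
            exact ⟨fun h => hy1 (hR.inj _ hy2 _ hx0 (h.trans hx0m.symm)), hmem y hy2⟩
          · rintro ⟨hi1, hi2⟩
            rw [← hR.1] at hi2
            obtain ⟨y, hy, rfl⟩ := Finset.mem_image.1 hi2
            exact ⟨y, ⟨fun h => hi1 (by rw [h, hx0m]), hy⟩, rfl⟩
        · rw [Finset.card_erase_of_mem hx0, Finset.card_erase_of_mem hm, hcard]
    · intro x hx hne
      rw [if_neg]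
      intro h
      have : m ∈ (σ.erase x).image row := Finset.mem_image.2 ⟨x0, Finset.mem_erase.2 ⟨hne.symm, hx0⟩, hx0m⟩
      rw [h.1] at this
      simp at this
    · intro h; exact absurd hx0 h
  · rw [if_neg hR]
    by_cases hex : ∃ x ∈ σ, RB row (I.erase m) (σ.erase x)
    swap
    · push Not at hex
      exact Finset.sum_eq_zero fun x hx => if_neg (hex x hx)
    obtain ⟨x0, hx0, hRx⟩ := hex
    have hne : row x0 ≠ m := by
      intro h
      apply hR
      refine ⟨?_, hcard⟩
      rw [← Finset.insert_erase hx0, Finset.image_insert, hRx.1, h, Finset.insert_erase hm]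
    have : row x0 ∈ (σ.erase x0).image row := by
      rw [hRx.1]; exact Finset.mem_erase.2 ⟨hne, hmem x0 hx0⟩
    obtain ⟨y0, hy0, hxy⟩ := Finset.mem_image.1 this
    obtain ⟨hyx, hyσ⟩ := Finset.mem_erase.1 hy0
    have hRy : RB row (I.erase m) (σ.erase y0) := by
      refine ⟨?_, ?_⟩
      · rw [← hRx.1]
        ext i
        simp only [Finset.mem_image, Finset.mem_erase]
        constructor
        · rintro ⟨z, ⟨hz1, hz2⟩, rfl⟩
          by_cases h : z = x0
          · exact ⟨y0, ⟨hyx, hyσ⟩, by rw [hxy, h]⟩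
          · exact ⟨z, ⟨h, hz2⟩, rfl⟩
        · rintro ⟨z, ⟨hz1, hz2⟩, rfl⟩
          by_cases h : z = y0
          · exact ⟨x0, ⟨hyx.symm, hx0⟩, by rw [← hxy, h]⟩
          · exact ⟨z, ⟨h, hz2⟩, rfl⟩
      · rw [← hRx.2, Finset.card_erase_of_mem hyσ, Finset.card_erase_of_mem hx0]
    have hsub : ({x0, y0} : Finset V) ⊆ σ := by
      intro z hz
      simp only [Finset.mem_insert, Finset.mem_singleton] at hz
      rcases hz with rfl | rfl <;> assumption
    rw [← Finset.sum_subset hsub]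
    · rw [Finset.sum_pair hyx.symm, if_pos hRx, if_pos hRy]
      -- consecutive elements
      have main : ∀ a b : V, a ∈ σ → b ∈ σ → row a = row b → a < b →
          RB row (I.erase m) (σ.erase a) → eps a σ + eps b σ = 0 := by
        intro a b ha hb hab hlt hRa
        have : σ.filter (· < b) = insert a (σ.filter (· < a)) := by
          ext z
          simp only [Finset.mem_filter, Finset.mem_insert]
          constructor
          · rintro ⟨hz, hzb⟩
            by_cases hza : z = a
            · exact Or.inl hza
            · right
              refine ⟨hz, ?_⟩
              by_contra hn
              have haz : a < z := lt_of_le_of_ne (not_lt.1 hn) (Ne.symm hza)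
              have e1 : ¬ row b < row z := fun h => lt_asymm hzb (hrow _ _ h)
              have e2 : ¬ row z < row a := fun h => lt_asymm haz (hrow _ _ h)
              have e3 : row z = row b := le_antisymm (not_lt.1 e1) (hab ▸ not_lt.1 e2)
              have := hRa.inj z (Finset.mem_erase.2 ⟨hza, hz⟩) b
                (Finset.mem_erase.2 ⟨hlt.ne', hb⟩) e3
              exact hzb.ne this
          · rintro (rfl | ⟨hz, hza⟩)
            · exact ⟨ha, hlt⟩
            · exact ⟨hz, hza.trans hlt⟩
        unfold eps
        rw [this, Finset.card_insert_of_notMem (by simp), pow_succ]; ring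
      rcases lt_or_gt_of_ne hyx with h | h
      · rw [add_comm]; exact main y0 x0 hyσ hx0 hxy h hRy
      · exact main x0 y0 hx0 hyσ hxy.symm h hRx
    · intro z hz hz'
      rw [if_neg]
      intro hRz
      simp only [Finset.mem_insert, Finset.mem_singleton, not_or] at hz'
      exact hyx (hRz.inj y0 (Finset.mem_erase.2 ⟨Ne.symm hz'.2, hyσ⟩) x0
        (Finset.mem_erase.2 ⟨Ne.symm hz'.1, hx0⟩) hxy)

open Classical in
noncomputable def RR (f : V → ℝ) (row : V → Fin n) (I : Finset (Fin n)) (c : Finset V → ℝ) : ℝ :=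
  ∑ σ ∈ (Finset.univ : Finset V).powerset, if RB row I σ then (∏ x ∈ σ, f x) * c σ else 0

open Classical in
lemma RR_bd (f : V → ℝ) (row : V → Fin n) (hrow : ∀ x y, row x < row y → x < y)
    (I : Finset (Fin n)) (m : Fin n)
    (hm : m ∈ I) (hmin : ∀ i ∈ I, m ≤ i) (c : Finset V → ℝ)
    (hc : ∀ σ, c σ ≠ 0 → σ ⊆ rowSet row I ∧ σ.card = I.card) :
    RR f row (I.erase m) (bd f c) = RR f row I c := by
  unfold RR
  have e1 : ∀ τ : Finset V, (if RB row (I.erase m) τ then (∏ x ∈ τ, f x) * bd f c τ else 0) =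
      ∑ x ∈ Finset.univ \ τ, (if RB row (I.erase m) ((insert x τ).erase x) then
        eps x (insert x τ) else 0) * ((∏ y ∈ insert x τ, f y) * c (insert x τ)) := by
    intro τ
    have : ∀ x ∈ Finset.univ \ τ, (if RB row (I.erase m) ((insert x τ).erase x) then
        eps x (insert x τ) else 0) * ((∏ y ∈ insert x τ, f y) * c (insert x τ)) =
        (if RB row (I.erase m) τ then (∏ y ∈ τ, f y) else 0) *
          (if x ∈ τ then 0 else eps x τ * f x * c (insert x τ)) := by
      intro x hx
      have hx' := (Finset.mem_sdiff.1 hx).2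
      rw [Finset.erase_insert hx', eps_insert_self, Finset.prod_insert hx', if_neg hx']
      split_ifs <;> ring
    rw [Finset.sum_congr rfl this, ← Finset.mul_sum,
      Finset.sum_subset (Finset.subset_univ (Finset.univ \ τ))
      (fun x _ hx => if_pos (by simpa using hx)), bd_apply]
    split_ifs <;> simp
  rw [Finset.sum_congr rfl fun τ _ => e1 τ, ← reindex Finset.univ (fun x σ =>
    (if RB row (I.erase m) (σ.erase x) then eps x σ else 0) * ((∏ y ∈ σ, f y) * c σ))]
  refine Finset.sum_congr rfl fun σ _ => ?_
  rw [← Finset.sum_mul]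
  by_cases h0 : c σ = 0
  · simp [h0]
  · rw [Qsum row hrow I m hm hmin σ (hc σ h0).1 (hc σ h0).2]
    split_ifs <;> simp

theorem rainbow (β : V → B) (γ : V → C) (f : V → ℝ) (hf : ∀ x, 0 < f x) (row : V → Fin n)
    (hrow : ∀ x y, row x < row y → x < y)
    (lam : ℝ) (hl : ∀ y, ∑ x, f x * KK β γ x y ≤ lam)
    (hF : ∀ (I : Finset (Fin n)) (k : ℕ), I.card = k + 1 →
      k * lam < ∑ x ∈ rowSet row I, f x) :
    ∃ σ : Finset V, σ.card = n ∧ ∀ x ∈ σ, ∀ y ∈ σ, x ≠ y →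
      row x ≠ row y ∧ β x ≠ β y ∧ γ x ≠ γ y := by
  classical
  obtain ⟨c, hc0, hc⟩ := chain_exists β γ f hf row lam hl hF n
  have hc : ∀ I, GoodChain β γ f row c I := fun I => hc I (by simpa using Finset.card_le_univ I)
  have hR : ∀ k, ∀ I : Finset (Fin n), I.card = k → RR f row I (c I) = 1 := by
    intro k
    induction k with
    | zero =>
      intro I hI
      have : I = ∅ := by simpa using hI
      subst this
      unfold RR
      rw [Finset.sum_eq_single ∅]
      · simp [RB, hc0]
      · intro σ _ h
        rw [if_neg]
        intro hRB
        exact h (by simpa using hRB.2)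
      · simp
    | succ k ih =>
      intro I hI
      have hne : I.Nonempty := Finset.card_pos.1 (by omega)
      have hm := I.min'_mem hne
      have hmin : ∀ i ∈ I, I.min' hne ≤ i := fun i hi => I.min'_le i hi
      set m := I.min' hne
      rw [← RR_bd f row hrow I m hm hmin (c I)
        (fun σ h => ⟨((hc I).1 σ h).1, ((hc I).1 σ h).2.1⟩), (hc I).2,
        ← ih (I.erase m) (by rw [Finset.card_erase_of_mem hm, hI]; rfl)]
      unfold RR
      refine Finset.sum_congr rfl fun σ _ => ?_
      by_cases hRB : RB row (I.erase m) σ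
      swap
      · rw [if_neg hRB, if_neg hRB]
      rw [if_pos hRB, if_pos hRB]
      congr 1
      rw [Finset.sum_apply, Finset.sum_eq_single m]
      · have : eps m I = 1 := by
          unfold eps
          rw [Finset.filter_false_of_mem (fun i hi => not_lt.2 (hmin i hi))]; simp
        simp [this]
      · intro i hi him
        rw [Pi.smul_apply, smul_eq_mul]
        have : c (I.erase i) σ = 0 := by
          by_contra hne
          have hs := ((hc (I.erase i)).1 σ hne).1
          have : i ∈ σ.image row := by rw [hRB.1]; exact Finset.mem_erase.2 ⟨him, hi⟩
          obtain ⟨x, hx, rfl⟩ := Finset.mem_image.1 this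
          have := hs hx
          simp [rowSet] at this
        rw [this, mul_zero]
      · intro h; exact absurd hm h
  have h1 := hR n Finset.univ (by simp)
  have : ∃ σ, RB row Finset.univ σ ∧ c Finset.univ σ ≠ 0 := by
    by_contra hn
    push Not at hn
    unfold RR at h1
    rw [Finset.sum_eq_zero] at h1
    · exact zero_ne_one h1
    · intro σ _
      split_ifs with h
      · rw [hn σ h, mul_zero]
      · rfl
  obtain ⟨σ, hRB, hne⟩ := this
  refine ⟨σ, by simpa using hRB.2, fun x hx y hy hxy => ⟨fun h => hxy (hRB.inj x hx y hy h), ?_⟩⟩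
  exact ((hc Finset.univ).1 σ hne).2.2 x hx y hy hxy
end tools

theorem bm_n_n_large (n : ℕ) (hn : 2 ≤ n) (heven : Even n)
    (H : Finset (Fin n × Fin n × Fin (n * (2 * n - 1) / 2)))
    (hH : TriFracBalanced H) :
    ∃ M, TriMatching H M ∧ M.card = n := by
  classical
  obtain ⟨f, ⟨hf0, hfH, hA, hB, hC⟩, hne⟩ := hH
  have hc2 : ((n * (2 * n - 1) / 2 : ℕ) : ℝ) = n * (n - 1 / 2) := by
    obtain ⟨r, rfl⟩ := heven
    have : (r + r) * (2 * (r + r) - 1) / 2 = r * (2 * (r + r) - 1) := by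
      rw [← two_mul, mul_assoc, Nat.mul_div_cancel_left _ (by norm_num)]
    rw [this]
    have h1 : 1 ≤ 2 * (r + r) := by omega
    push_cast [Nat.cast_sub h1]; ring
  generalize hcdef : n * (2 * n - 1) / 2 = c at *
  obtain ⟨e0, he0⟩ : ∃ e, f e ≠ 0 := by
    by_contra h; push Not at h; exact hne (funext h)
  set W := ∑ e, f e with hW
  have hWpos : 0 < W := Finset.sum_pos' (fun e _ => hf0 e)
    ⟨e0, Finset.mem_univ _, lt_of_le_of_ne (hf0 e0) (Ne.symm he0)⟩
  have tot : ∀ {D : ℕ} (p : Fin n × Fin n × Fin c → Fin D),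
      ∑ v, ∑ e, (if p e = v then f e else 0) = W := by
    intro D p
    rw [Finset.sum_comm]
    simp [hW]
  have dA : ∀ v, (n:ℝ) * ∑ e, (if e.1 = v then f e else 0) = W := by
    intro v
    rw [← tot (fun e => e.1), Finset.sum_congr rfl fun w _ => hA w v]; simp
  have dB : ∀ v, (n:ℝ) * ∑ e, (if e.2.1 = v then f e else 0) = W := by
    intro v
    rw [← tot (fun e => e.2.1), Finset.sum_congr rfl fun w _ => hB w v]; simp
  have dC : ∀ v, (c:ℝ) * ∑ e, (if e.2.2 = v then f e else 0) = W := by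
    intro v
    rw [← tot (fun e => e.2.2), Finset.sum_congr rfl fun w _ => hC w v]; simp
  have hn' : (2:ℝ) ≤ n := by exact_mod_cast hn
  have hnpos : (0:ℝ) < n := by linarith
  have hcpos : (0:ℝ) < c := by rw [hc2]; apply mul_pos <;> linarith
  have sub : ∀ g : Fin n × Fin n × Fin c → ℝ,
      ∑ x : {e // 0 < f e}, f x.1 * g x.1 = ∑ e, f e * g e := by
    intro g
    rw [← Finset.sum_subset (Finset.subset_univ (Finset.univ.filter fun e => 0 < f e))]
    · exact (Finset.sum_subtype _ (by simp) (fun e => f e * g e)).symm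
    · intro e _ he
      have : f e = 0 := le_antisymm (not_lt.1 fun h => he (by simpa using h)) (hf0 e)
      rw [this, zero_mul]
  let key : {e // 0 < f e} → (Fin n ×ₗ (Fin n ×ₗ Fin c)) := fun e => toLex (e.1.1, toLex e.1.2)
  have hkey : Function.Injective key := by
    rintro ⟨⟨a, b⟩, h⟩ ⟨⟨a', b'⟩, h'⟩ he
    simpa [key] using he
  letI : LinearOrder {e // 0 < f e} := LinearOrder.lift' key hkey
  obtain ⟨σ, h1, h2⟩ := rainbow (V := {e // 0 < f e}) (fun e => e.1.2.1) (fun e => e.1.2.2)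
    (fun e => f e.1) (fun e => e.2) (fun e => e.1.1)
    (by
      intro x y h
      change key x < key y
      exact Prod.Lex.toLex_lt_toLex.2 (Or.inl h))
    (W / n + W / c)
    (by
      intro y
      refine le_of_eq ?_
      unfold KK
      rw [sub (fun x => (if x.2.1 = y.1.2.1 then (1:ℝ) else 0) + if x.2.2 = y.1.2.2 then 1 else 0)]
      simp only [mul_add, Finset.sum_add_distrib, mul_ite, mul_one, mul_zero]
      rw [← dB y.1.2.1, mul_div_cancel_left₀ _ hnpos.ne', dB y.1.2.1, ← dC y.1.2.2,
        mul_div_cancel_left₀ _ hcpos.ne'])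
    (by
      intro I k hk
      have e : ∑ x ∈ rowSet (fun e : {e // 0 < f e} => e.1.1) I, f x.1 = (k + 1) * (W / n) := by
        unfold rowSet
        rw [Finset.sum_filter]
        have e1 := sub (fun x => if x.1 ∈ I then 1 else 0)
        simp only [mul_ite, mul_one, mul_zero] at e1
        rw [e1]
        have e2 : ∀ e : Fin n × Fin n × Fin c, (if e.1 ∈ I then f e else 0) =
            ∑ i ∈ I, if e.1 = i then f e else 0 := by
          intro e; simp
        rw [Finset.sum_congr rfl fun e _ => e2 e, Finset.sum_comm]
        have e3 : ∀ i ∈ I, ∑ e : Fin n × Fin n × Fin c, (if e.1 = i then f e else 0) = W / n := by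
          intro i _
          rw [← dA i, mul_div_cancel_left₀ _ hnpos.ne']
        rw [Finset.sum_congr rfl e3, Finset.sum_const, hk, nsmul_eq_mul]
        push_cast; ring
      have hkn : (k:ℝ) + 1 ≤ n := by
        have := Finset.card_le_univ I
        rw [hk, Fintype.card_fin] at this
        exact_mod_cast this
      refine lt_of_lt_of_eq ?_ e.symm
      have : k * (W / c) < W / n := by
        rw [hc2, mul_div_assoc', div_lt_div_iff₀ (by rw [← hc2]; exact hcpos) hnpos]
        have : (k:ℝ) < n - 1 / 2 := by linarith
        have := mul_lt_mul_of_pos_left this (mul_pos hWpos hnpos)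
        nlinarith
      linarith)
  refine ⟨σ.map (Function.Embedding.subtype _), ⟨?_, ?_⟩, by simpa using h1⟩
  · intro e he
    obtain ⟨x, _, rfl⟩ := Finset.mem_map.1 he
    by_contra h
    exact x.2.ne' (hfH _ h)
  · intro e he e' he' hne
    obtain ⟨x, hx, rfl⟩ := Finset.mem_map.1 he
    obtain ⟨y, hy, rfl⟩ := Finset.mem_map.1 he'
    exact h2 x hx y hy (fun h => hne (by rw [h]))
end

section
/- Let n ≥ 2 be an integer. Then every (n, n, n(n−1)/2)-fractionally balanced tripartite hypergraph contains a matching of size n−1. -/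
section Abstract
open Classical in
/-- Antisymmetry of a function on tuples. -/
def TupAlt {V : Type*} {j : ℕ} (f : (Fin (j+1) → V) → ℝ) : Prop :=
  ∀ i : Fin (j+1), i ≠ 0 → ∀ x, f (x ∘ Equiv.swap 0 i) = - f x

theorem TupAlt.swap {V : Type*} {j : ℕ} {f : (Fin (j+1) → V) → ℝ} (hf : TupAlt f)
    (i l : Fin (j+1)) (hil : i ≠ l) (x : Fin (j+1) → V) :
    f (x ∘ Equiv.swap i l) = - f x := by
  by_cases hi : i = 0
  · subst hi; exact hf l (Ne.symm hil) x
  by_cases hl : l = 0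
  · subst hl; rw [Equiv.swap_comm]; exact hf i hi x
  have h : Equiv.swap i l = Equiv.swap 0 i * Equiv.swap 0 l * Equiv.swap 0 i := by
    have := Equiv.swap_mul_swap_mul_swap (x := l) (y := 0) (z := i) hl (Ne.symm hil)
    rw [Equiv.swap_comm l 0] at this
    exact this.symm
  have h2 : x ∘ Equiv.swap i l =
      ((x ∘ Equiv.swap 0 i) ∘ Equiv.swap 0 l) ∘ Equiv.swap 0 i := by
    rw [h]; rfl
  rw [h2, hf i hi, hf l hl, hf i hi]; ring

/-- Simplicial boundary on tuple functions. -/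
noncomputable def wbd {V : Type*} [Fintype V] (w : V → ℝ) {j : ℕ} (g : (Fin (j+1) → V) → ℝ)
    (y : Fin j → V) : ℝ := ∑ v, w v * g (Fin.cons v y)

/-- Pairwise compatible tuples of active elements. -/
def TupGood {V : Type*} (conf : V → V → Prop) (w : V → ℝ) {j : ℕ} (x : Fin j → V) : Prop :=
  (∀ i l, i ≠ l → ¬ conf (x i) (x l)) ∧ ∀ i, 0 < w (x i)

open Classical in
/-- Coboundary. -/
noncomputable def cob {V : Type*} (conf : V → V → Prop) (w : V → ℝ) {j : ℕ}
    (f : (Fin (j+1) → V) → ℝ) (z : Fin (j+2) → V) : ℝ :=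
  if TupGood conf w z then
    f (Fin.tail z) - ∑ i, f (Function.update (Fin.tail z) i (z 0)) else 0

theorem TupGood.swap {V : Type*} {conf : V → V → Prop} {w : V → ℝ} {j : ℕ} {x : Fin j → V}
    (h : TupGood conf w x) (a b : Fin j) : TupGood conf w (x ∘ Equiv.swap a b) :=
  ⟨fun _ _ hil => h.1 _ _ (fun e => hil ((Equiv.swap a b).injective e)), fun _ => h.2 _⟩

theorem TupGood.swap_iff {V : Type*} {conf : V → V → Prop} {w : V → ℝ} {j : ℕ} {x : Fin j → V}
    (a b : Fin j) : TupGood conf w (x ∘ Equiv.swap a b) ↔ TupGood conf w x := by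
  refine ⟨fun h => ?_, fun h => h.swap a b⟩
  have := h.swap a b
  have e : (x ∘ Equiv.swap a b) ∘ Equiv.swap a b = x := by
    funext i; simp
  rwa [e] at this

theorem TupGood.of_cons {V : Type*} {conf : V → V → Prop} {w : V → ℝ} {j : ℕ} {x : Fin j → V}
    {v : V} (h : TupGood conf w (Fin.cons v x : Fin (j+1) → V)) : TupGood conf w x := by
  refine ⟨fun i l hil => ?_, fun i => ?_⟩
  · have := h.1 i.succ l.succ (by simpa using hil)
    simpa using this
  · simpa using h.2 i.succ

theorem cob_alt {V : Type*} (conf : V → V → Prop) (w : V → ℝ) {j : ℕ}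
    {f : (Fin (j+1) → V) → ℝ} (hf : TupAlt f) : TupAlt (cob conf w f) := by
  intro i hi z
  obtain ⟨i, rfl⟩ := Fin.exists_succ_eq.mpr hi
  unfold cob
  rw [TupGood.swap_iff]
  split_ifs with hg
  swap
  · simp
  set x := Fin.tail z with hx
  set v := z 0 with hv
  have h1 : Fin.tail (z ∘ Equiv.swap 0 i.succ) = Function.update x i v := by
    funext l
    by_cases hl : l = i
    · subst hl; simp [Fin.tail, hv]
    · simp only [Fin.tail, Function.comp, Function.update_of_ne hl, hx]
      rw [Equiv.swap_apply_of_ne_of_ne (by simp) (by simpa using hl)]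
  have h2 : (z ∘ Equiv.swap 0 i.succ) 0 = x i := by simp [hx, Fin.tail]
  rw [h1, h2, ← Finset.add_sum_erase _ _ (Finset.mem_univ i),
    ← Finset.add_sum_erase Finset.univ (fun l => f (Function.update x l v)) (Finset.mem_univ i)]
  have h3 : ∀ l ∈ Finset.univ.erase i, f (Function.update (Function.update x i v) l (x i)) =
      - f (Function.update x l v) := by
    intro l hl
    have hl' : l ≠ i := Finset.ne_of_mem_erase hl
    rw [← hf.swap l i hl']
    congr 1
    funext k
    simp only [Function.comp, Function.update_apply, Equiv.swap_apply_def]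
    grind
  rw [Finset.sum_congr rfl h3, Finset.sum_neg_distrib]
  simp
  ring

theorem wbd_alt {V : Type*} [Fintype V] (w : V → ℝ) {j : ℕ} {g : (Fin (j+2) → V) → ℝ}
    (hg : TupAlt g) : TupAlt (wbd w g) := by
  intro i hi x
  unfold wbd
  rw [← Finset.sum_neg_distrib]
  refine Finset.sum_congr rfl fun v _ => ?_
  have : (Fin.cons v (x ∘ Equiv.swap 0 i) : Fin (j+2) → V) =
      (Fin.cons v x : Fin (j+2) → V) ∘ Equiv.swap (Fin.succ 0) i.succ := by
    funext k
    refine Fin.cases ?_ (fun k => ?_) k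
    · simp only [Fin.cons_zero, Function.comp]
      rw [Equiv.swap_apply_of_ne_of_ne (Fin.succ_ne_zero 0).symm (Fin.succ_ne_zero i).symm]; simp
    · simp only [Fin.cons_succ, Function.comp]
      have : Equiv.swap (Fin.succ 0) i.succ k.succ = (Equiv.swap 0 i k).succ := by
        simp only [Equiv.swap_apply_def, Fin.succ_inj]
        split_ifs <;> rfl
      rw [this, Fin.cons_succ]
  rw [this, hg.swap _ _ (fun e => hi (Fin.succ_injective _ e).symm)]
  ring

theorem wbd_wbd {V : Type*} [Fintype V] (w : V → ℝ) {j : ℕ} {g : (Fin (j+2) → V) → ℝ}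
    (hg : TupAlt g) : wbd w (wbd w g) = 0 := by
  funext y
  simp only [wbd, Pi.zero_apply, Finset.mul_sum]
  have key : ∀ u v, g (Fin.cons u (Fin.cons v y : Fin (j+1) → V)) =
      - g (Fin.cons v (Fin.cons u y : Fin (j+1) → V)) := by
    intro u v
    rw [← hg (Fin.succ 0) (Fin.succ_ne_zero 0)]
    congr 1
    funext k
    refine Fin.cases ?_ (fun k => Fin.cases ?_ (fun k => ?_) k) k
    · simp only [Function.comp, Equiv.swap_apply_left, Fin.cons_succ, Fin.cons_zero]
    · simp only [Function.comp, Equiv.swap_apply_right, Fin.cons_succ, Fin.cons_zero]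
    · simp only [Function.comp]
      rw [Equiv.swap_apply_of_ne_of_ne (Fin.succ_ne_zero _) (fun e => Fin.succ_ne_zero _ (Fin.succ_injective _ e))]
      simp
  have h : ∑ v, ∑ u, w v * (w u * g (Fin.cons u (Fin.cons v y : Fin (j+1) → V))) =
      - ∑ v, ∑ u, w v * (w u * g (Fin.cons u (Fin.cons v y : Fin (j+1) → V))) := by
    conv_lhs => rw [Finset.sum_comm]
    rw [← Finset.sum_neg_distrib]
    refine Finset.sum_congr rfl fun u _ => ?_
    rw [← Finset.sum_neg_distrib]
    refine Finset.sum_congr rfl fun v _ => ?_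
    rw [key u v]; ring
  linarith

open Classical in
/-- The one-variable inequality. -/
theorem quad_ineq {V : Type*} [Fintype V] (conf : V → V → Prop) (w : V → ℝ) (m : V → V → ℝ)
    (hw : ∀ v, 0 ≤ w v) (hsym : ∀ u v, conf u v ↔ conf v u) (hmsym : ∀ u v, m u v = m v u)
    (hm : ∀ u v, (if conf u v then 1 else 0) ≤ m u v)
    (hpsd : ∀ F : V → ℝ, 0 ≤ ∑ u, ∑ v, m u v * F u * F v) (F : V → ℝ) :
    0 ≤ ∑ u, ∑ v, w u * w v * ((if conf u v then 1 else 0) * (F u * F v)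
      + (m u v - if conf u v then 1 else 0) * F u ^ 2) := by
  set r : V → V → ℝ := fun u v => m u v - if conf u v then 1 else 0 with hr
  have hr0 : ∀ u v, 0 ≤ r u v := fun u v => sub_nonneg.mpr (hm u v)
  have hrs : ∀ u v, r u v = r v u := by
    intro u v; simp only [hr, hmsym u v, hsym u v]
  have e1 : ∑ u, ∑ v, w u * w v * ((if conf u v then 1 else 0) * (F u * F v)
      + (m u v - if conf u v then 1 else 0) * F u ^ 2) =
      (∑ u, ∑ v, m u v * (w u * F u) * (w v * F v)) +
      ∑ u, ∑ v, w u * w v * r u v * (F u ^ 2 - F u * F v) := by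
    rw [← Finset.sum_add_distrib]
    refine Finset.sum_congr rfl fun u _ => ?_
    rw [← Finset.sum_add_distrib]
    refine Finset.sum_congr rfl fun v _ => ?_
    simp only [hr]; ring
  have e2 : ∑ u, ∑ v, w u * w v * r u v * (F u ^ 2 - F u * F v) =
      ∑ u, ∑ v, w u * w v * r u v * (F v ^ 2 - F u * F v) := by
    rw [Finset.sum_comm]
    refine Finset.sum_congr rfl fun u _ => Finset.sum_congr rfl fun v _ => ?_
    rw [hrs v u]; ring
  have e3 : 0 ≤ ∑ u, ∑ v, w u * w v * r u v * (F u ^ 2 - F u * F v) +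
      ∑ u, ∑ v, w u * w v * r u v * (F v ^ 2 - F u * F v) := by
    rw [← Finset.sum_add_distrib]
    refine Finset.sum_nonneg fun u _ => ?_
    rw [← Finset.sum_add_distrib]
    refine Finset.sum_nonneg fun v _ => ?_
    have h1 : 0 ≤ w u * w v * r u v := mul_nonneg (mul_nonneg (hw u) (hw v)) (hr0 u v)
    have : w u * w v * r u v * (F u ^ 2 - F u * F v) + w u * w v * r u v * (F v ^ 2 - F u * F v)
      = w u * w v * r u v * (F u - F v) ^ 2 := by ring
    rw [this]; positivity
  rw [e1]
  have := hpsd (fun u => w u * F u)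
  linarith

open Classical in
theorem garland_bracket {V : Type*} [Fintype V] (conf : V → V → Prop) (w : V → ℝ) (m : V → V → ℝ)
    (hw : ∀ v, 0 ≤ w v) (hsym : ∀ u v, conf u v ↔ conf v u) (hmsym : ∀ u v, m u v = m v u)
    (hm : ∀ u v, (if conf u v then 1 else 0) ≤ m u v)
    (hpsd : ∀ F : V → ℝ, 0 ≤ ∑ u, ∑ v, m u v * F u * F v) {j : ℕ}
    (f : (Fin (j+1) → V) → ℝ) (i : Fin (j+1)) :
    0 ≤ ∑ x : Fin (j+1) → V, (∏ l, w (x l)) * ∑ v, w v *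
      ((if conf (x i) v then 1 else 0) * (f x * f (Function.update x i v))
        + (m (x i) v - if conf (x i) v then 1 else 0) * f x ^ 2) := by
  rw [← (Fin.insertNthEquiv (fun _ => V) i).sum_comp, Fintype.sum_prod_type, Finset.sum_comm]
  refine Finset.sum_nonneg fun y _ => ?_
  have := quad_ineq conf w m hw hsym hmsym hm hpsd (fun u => f (i.insertNth u y))
  have h2 := mul_nonneg (Finset.prod_nonneg fun l (_ : l ∈ Finset.univ) => hw (y l)) this
  refine h2.trans_eq ?_
  rw [Finset.mul_sum]
  refine Finset.sum_congr rfl fun u _ => ?_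
  have hins : ∀ u, Fin.insertNthEquiv (fun _ => V) i (u, y) = i.insertNth u y := fun _ => rfl
  simp only [hins, Fin.prod_univ_succAbove _ i, Fin.insertNth_apply_same,
    Fin.insertNth_apply_succAbove, Fin.update_insertNth, Finset.mul_sum]
  refine Finset.sum_congr rfl fun v _ => ?_
  ring

theorem wbd_update {V : Type*} [Fintype V] (w : V → ℝ) {j : ℕ} {f : (Fin (j+1) → V) → ℝ}
    (hf : TupAlt f) (h0 : wbd w f = 0) (i : Fin (j+1)) (x : Fin (j+1) → V) :
    ∑ v, w v * f (Function.update x i v) = 0 := by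
  have h1 : ∀ v, (Function.update x i v) ∘ Equiv.swap 0 i =
      (Fin.cons v (Fin.tail (x ∘ Equiv.swap 0 i)) : Fin (j+1) → V) := by
    intro v
    funext k
    refine Fin.cases ?_ (fun k => ?_) k
    · simp
    · simp only [Fin.cons_succ, Fin.tail, Function.comp]
      rw [Function.update_of_ne]
      intro e
      have := congrArg (Equiv.swap 0 i) e
      simp at this
  have h2 := congrFun h0 (Fin.tail (x ∘ Equiv.swap 0 i))
  simp only [wbd, ← h1, Pi.zero_apply] at h2
  by_cases hi : i = 0
  · subst hi; simpa using h2
  · simp only [hf i hi, mul_neg, Finset.sum_neg_distrib] at h2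
    linarith

open Classical in
theorem garland {V : Type*} [Fintype V] (conf : V → V → Prop) (w : V → ℝ) (m : V → V → ℝ)
    (hw : ∀ v, 0 ≤ w v) (hsym : ∀ u v, conf u v ↔ conf v u) (hmsym : ∀ u v, m u v = m v u)
    (hm : ∀ u v, (if conf u v then 1 else 0) ≤ m u v)
    (hpsd : ∀ F : V → ℝ, 0 ≤ ∑ u, ∑ v, m u v * F u * F v)
    (s : ℝ) (hrow : ∀ u, 0 < w u → ∑ v, w v * m u v ≤ s) {j : ℕ}
    (hs : (j + 1) * s < ∑ v, w v)
    (f : (Fin (j+1) → V) → ℝ) (hf : TupAlt f) (hg : ∀ x, f x ≠ 0 → TupGood conf w x)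
    (h0 : wbd w f = 0) (h1 : wbd w (cob conf w f) = 0) : f = 0 := by
  set W := ∑ v, w v with hW
  have pt : ∀ x, f x ^ 2 * (W - (j + 1) * s) + ∑ i, ∑ v, w v *
      ((if conf (x i) v then 1 else 0) * (f x * f (Function.update x i v))
        + (m (x i) v - if conf (x i) v then 1 else 0) * f x ^ 2) ≤ 0 := by
    intro x
    by_cases hx : f x = 0
    · simp [hx]
    have hgx := hg x hx
    have hA := congrFun h1 x
    simp only [wbd, cob, Pi.zero_apply, Fin.tail_cons, Fin.cons_zero] at hA
    have hC : ∀ v i, w v * (if TupGood conf w (Fin.cons v x : Fin (j+2) → V) then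
        f (Function.update x i v) else 0) =
        w v * ((1 - if conf (x i) v then 1 else 0) * f (Function.update x i v)) := by
      intro v i
      by_cases hv : w v = 0
      · simp [hv]
      have hv : 0 < w v := lt_of_le_of_ne (hw v) (Ne.symm hv)
      by_cases hu : f (Function.update x i v) = 0
      · simp [hu]
      have hgu := hg _ hu
      have : TupGood conf w (Fin.cons v x : Fin (j+2) → V) ↔ ¬ conf (x i) v := by
        constructor
        · intro h
          simpa using h.1 i.succ 0 (Fin.succ_ne_zero i)
        · intro h
          have h' : ∀ l, ¬ conf (x l) v := by
            intro l
            by_cases hl : l = i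
            · rw [hl]; exact h
            · simpa [Function.update_of_ne hl] using hgu.1 l i hl
          refine ⟨fun a b => ?_, fun a => ?_⟩
          · refine Fin.cases ?_ (fun a => ?_) a <;> refine Fin.cases ?_ (fun b => ?_) b
            · simp
            · intro _; simpa [hsym v] using h' b
            · intro _; simpa using h' a
            · intro hab; simpa using hgx.1 a b (by simpa using hab)
          · refine Fin.cases ?_ (fun a => ?_) a
            · simpa using hv
            · simpa using hgx.2 a
      by_cases hc : conf (x i) v <;> simp [this, hc]
    have hD : ∀ v, w v - ∑ i, w v * (if conf (x i) v then 1 else 0) ≤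
        w v * (if TupGood conf w (Fin.cons v x : Fin (j+2) → V) then 1 else 0) := by
      intro v
      have hn : ∀ i ∈ Finset.univ, 0 ≤ w v * (if conf (x i) v then (1:ℝ) else 0) := by
        intro i _
        exact mul_nonneg (hw v) (by split_ifs <;> norm_num)
      split_ifs with h
      · have := Finset.sum_nonneg hn
        linarith
      · by_cases hv : w v = 0
        · simp [hv]
        have hv : 0 < w v := lt_of_le_of_ne (hw v) (Ne.symm hv)
        have : ∃ i, conf (x i) v := by
          by_contra hcon
          push Not at hcon
          apply h
          refine ⟨fun a b => ?_, fun a => ?_⟩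
          · refine Fin.cases ?_ (fun a => ?_) a <;> refine Fin.cases ?_ (fun b => ?_) b
            · simp
            · intro _; simpa [hsym v] using hcon b
            · intro _; simpa using hcon a
            · intro hab; simpa using hgx.1 a b (by simpa using hab)
          · refine Fin.cases ?_ (fun a => ?_) a
            · simpa using hv
            · simpa using hgx.2 a
        obtain ⟨i, hi⟩ := this
        have := Finset.single_le_sum hn (Finset.mem_univ i)
        simp only [hi, if_true] at this
        linarith
    have hA2 : f x * ∑ v, w v * (if TupGood conf w (Fin.cons v x : Fin (j+2) → V) then 1 else 0)
        + ∑ i, ∑ v, w v * ((if conf (x i) v then 1 else 0) * f (Function.update x i v)) = 0 := by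
      have e1 : ∑ i, ∑ v, w v * ((if conf (x i) v then 1 else 0) * f (Function.update x i v)) =
          - ∑ i, ∑ v, w v * (if TupGood conf w (Fin.cons v x : Fin (j+2) → V) then
        f (Function.update x i v) else 0) := by
        rw [← Finset.sum_neg_distrib]
        refine Finset.sum_congr rfl fun i _ => ?_
        have := wbd_update w hf h0 i x
        rw [Finset.sum_congr rfl fun v _ => hC v i, eq_neg_iff_add_eq_zero,
          ← Finset.sum_add_distrib, ← this]
        refine Finset.sum_congr rfl fun v _ => ?_
        ring
      refine Eq.trans ?_ hA
      rw [e1, Finset.sum_comm, Finset.mul_sum, ← sub_eq_add_neg, ← Finset.sum_sub_distrib]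
      refine Finset.sum_congr rfl fun v _ => ?_
      split_ifs
      · rw [← Finset.mul_sum]; ring
      · simp
    have hD2 : W - ∑ i, ∑ v, w v * (if conf (x i) v then 1 else 0) ≤
        ∑ v, w v * (if TupGood conf w (Fin.cons v x : Fin (j+2) → V) then 1 else 0) := by
      rw [Finset.sum_comm, hW, ← Finset.sum_sub_distrib]
      exact Finset.sum_le_sum fun v _ => hD v
    have hE : ∑ i, ∑ v, w v * m (x i) v ≤ (j + 1) * s := by
      have := Finset.sum_le_card_nsmul Finset.univ (fun i => ∑ v, w v * m (x i) v) s
        (fun i _ => hrow (x i) (hgx.2 i))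
      simpa using this
    have e2 : ∑ i, ∑ v, w v *
      ((if conf (x i) v then 1 else 0) * (f x * f (Function.update x i v))
        + (m (x i) v - if conf (x i) v then 1 else 0) * f x ^ 2) =
        f x * (∑ i, ∑ v, w v * ((if conf (x i) v then 1 else 0) * f (Function.update x i v)))
        + f x ^ 2 * (∑ i, ∑ v, w v * m (x i) v)
        - f x ^ 2 * (∑ i, ∑ v, w v * (if conf (x i) v then 1 else 0)) := by
      simp only [Finset.mul_sum, ← Finset.sum_add_distrib, ← Finset.sum_sub_distrib]
      refine Finset.sum_congr rfl fun i _ => Finset.sum_congr rfl fun v _ => ?_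
      ring
    rw [e2]
    have hsq : 0 ≤ f x ^ 2 := sq_nonneg _
    have k1 := mul_le_mul_of_nonneg_left hD2 hsq
    have k2 := mul_le_mul_of_nonneg_left hE hsq
    have k3 := congrArg (fun t => f x * t) hA2
    simp only [mul_zero, mul_add] at k3
    nlinarith
  have tot : ∑ x, (∏ l, w (x l)) * (f x ^ 2 * (W - (j + 1) * s)) ≤ 0 := by
    have h2 : ∑ x, (∏ l, w (x l)) * (f x ^ 2 * (W - (j + 1) * s) + ∑ i, ∑ v, w v *
      ((if conf (x i) v then 1 else 0) * (f x * f (Function.update x i v))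
        + (m (x i) v - if conf (x i) v then 1 else 0) * f x ^ 2)) ≤ 0 :=
      Finset.sum_nonpos fun x _ => mul_nonpos_of_nonneg_of_nonpos
        (Finset.prod_nonneg fun l _ => hw (x l)) (pt x)
    simp only [mul_add (∏ l, w _), Finset.sum_add_distrib] at h2
    have h3 := Finset.sum_nonneg fun i (_ : i ∈ Finset.univ) =>
      garland_bracket conf w m hw hsym hmsym hm hpsd f i
    rw [Finset.sum_comm] at h3
    simp only [← Finset.mul_sum] at h3
    linarith
  have hpos : 0 < W - (j + 1) * s := by linarith
  have hnn : ∀ x ∈ Finset.univ, 0 ≤ (∏ l, w (x l)) * (f x ^ 2 * (W - (j + 1) * s)) := by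
    intro x _
    exact mul_nonneg (Finset.prod_nonneg fun l _ => hw (x l)) (by positivity)
  have hz := (Finset.sum_eq_zero_iff_of_nonneg hnn).1 (le_antisymm tot (Finset.sum_nonneg hnn))
  funext x
  by_contra hx
  have hx : f x ≠ 0 := hx
  have h5 := hz x (Finset.mem_univ x)
  have : 0 < (∏ l, w (x l)) * (f x ^ 2 * (W - (j + 1) * s)) :=
    mul_pos (Finset.prod_pos fun l _ => (hg x hx).2 l) (by positivity)
  linarith

/-- The space of weighted cycles. -/
def cycSpace {V : Type*} [Fintype V] (conf : V → V → Prop) (w : V → ℝ) (j : ℕ) :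
    Submodule ℝ ((Fin (j+1) → V) → ℝ) where
  carrier := {f | TupAlt f ∧ (∀ x, ¬ TupGood conf w x → f x = 0) ∧ wbd w f = 0}
  add_mem' := by
    rintro f g ⟨h1, h2, h3⟩ ⟨k1, k2, k3⟩
    refine ⟨fun i hi x => ?_, fun x hx => ?_, ?_⟩
    · simp only [Pi.add_apply, h1 i hi, k1 i hi]; ring
    · simp [h2 x hx, k2 x hx]
    · funext y
      have a := congrFun h3 y
      have b := congrFun k3 y
      simp only [wbd, Pi.zero_apply, Pi.add_apply, mul_add, Finset.sum_add_distrib] at *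
      linarith
  zero_mem' := by
    refine ⟨fun i hi x => by simp, fun x hx => rfl, ?_⟩
    funext y; simp [wbd]
  smul_mem' := by
    rintro r f ⟨h1, h2, h3⟩
    refine ⟨fun i hi x => ?_, fun x hx => ?_, ?_⟩
    · simp [h1 i hi]
    · simp [h2 x hx]
    · funext y
      have a := congrFun h3 y
      simp only [wbd, Pi.zero_apply, Pi.smul_apply, smul_eq_mul] at *
      rw [← mul_zero r, ← a, Finset.mul_sum]
      exact Finset.sum_congr rfl fun v _ => by ring

theorem wbd_cob_mem {V : Type*} [Fintype V] (conf : V → V → Prop) (w : V → ℝ) (j : ℕ)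
    (f : (Fin (j+1) → V) → ℝ) (hf : f ∈ cycSpace conf w j) :
    wbd w (cob conf w f) ∈ cycSpace conf w j := by
  have ha := cob_alt conf w hf.1
  refine ⟨wbd_alt w ha, fun x hx => ?_, wbd_wbd w ha⟩
  unfold wbd
  refine Finset.sum_eq_zero fun v _ => ?_
  rw [cob, if_neg (fun h => hx (TupGood.of_cons h)), mul_zero]

/-- The operator on cycles. -/
noncomputable def cycOp {V : Type*} [Fintype V] (conf : V → V → Prop) (w : V → ℝ) (j : ℕ) :
    cycSpace conf w j →ₗ[ℝ] cycSpace conf w j where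
  toFun f := ⟨wbd w (cob conf w f.1), wbd_cob_mem conf w j f.1 f.2⟩
  map_add' := by
    intro f g
    ext x
    simp only [wbd, Submodule.coe_add, Pi.add_apply, ← Finset.sum_add_distrib]
    refine Finset.sum_congr rfl fun v _ => ?_
    simp only [cob, Pi.add_apply, Finset.sum_add_distrib]
    split_ifs <;> ring
  map_smul' := by
    intro r f
    ext x
    simp only [wbd, Submodule.coe_smul, Pi.smul_apply, smul_eq_mul, Finset.mul_sum,
      RingHom.id_apply]
    refine Finset.sum_congr rfl fun v _ => ?_
    simp only [cob, Pi.smul_apply, smul_eq_mul, ← Finset.mul_sum]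
    split_ifs <;> ring

open Classical in
/-- Exactness: cycles are boundaries (unweighted form). -/
theorem exact_chain {V : Type*} [Fintype V] (conf : V → V → Prop) (w : V → ℝ) (m : V → V → ℝ)
    (hw : ∀ v, 0 ≤ w v) (hsym : ∀ u v, conf u v ↔ conf v u) (hmsym : ∀ u v, m u v = m v u)
    (hm : ∀ u v, (if conf u v then 1 else 0) ≤ m u v)
    (hpsd : ∀ F : V → ℝ, 0 ≤ ∑ u, ∑ v, m u v * F u * F v)
    (s : ℝ) (hrow : ∀ u, 0 < w u → ∑ v, w v * m u v ≤ s) {j : ℕ}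
    (hs : (j + 1) * s < ∑ v, w v)
    (g : (Fin (j+1) → V) → ℝ) (hg : TupAlt g) (hgood : ∀ x, ¬ TupGood conf w x → g x = 0)
    (h0 : wbd (fun _ => 1) g = 0) :
    ∃ h : (Fin (j+2) → V) → ℝ, TupAlt h ∧ (∀ x, ¬ TupGood conf w x → h x = 0) ∧
      wbd (fun _ => 1) h = g := by
  have hinj : Function.Injective (cycOp conf w j) := by
    rw [← LinearMap.ker_eq_bot, LinearMap.ker_eq_bot']
    intro f hf
    apply Subtype.ext
    refine garland conf w m hw hsym hmsym hm hpsd s hrow hs f.1 f.2.1 ?_ f.2.2.2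
      (congrArg Subtype.val hf)
    intro x hx
    by_contra hc
    exact hx (f.2.2.1 x hc)
  have hsurj := LinearMap.injective_iff_surjective.1 hinj
  have pswap : ∀ (k : ℕ) (x : Fin k → V) (a b : Fin k),
      ∏ l, w ((x ∘ Equiv.swap a b) l) = ∏ l, w (x l) := by
    intro k x a b
    exact Equiv.prod_comp (Equiv.swap a b) (fun l => w (x l))
  have hmem : (fun x => g x / ∏ l, w (x l)) ∈ cycSpace conf w j := by
    refine ⟨fun i hi x => ?_, fun x hx => by simp [hgood x hx], ?_⟩
    · simp only [pswap, hg i hi, neg_div]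
    · funext y
      have a := congrFun h0 y
      simp only [wbd, Pi.zero_apply, one_mul, Fin.prod_univ_succ, Fin.cons_zero,
        Fin.cons_succ] at *
      rw [← zero_div (∏ l, w (y l)), ← a, Finset.sum_div]
      refine Finset.sum_congr rfl fun v _ => ?_
      by_cases hv : w v = 0
      · have : g (Fin.cons v y) = 0 := by
          apply hgood
          intro h
          have := h.2 0
          simp [hv] at this
        simp [this]
      · field_simp
  obtain ⟨f, hf⟩ := hsurj ⟨_, hmem⟩
  have hf : wbd w (cob conf w f.1) = fun x => g x / ∏ l, w (x l) := congrArg Subtype.val hf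
  refine ⟨fun z => cob conf w f.1 z * ∏ l, w (z l), fun i hi x => ?_, fun x hx => ?_, ?_⟩
  · simp only [pswap, cob_alt conf w f.2.1 i hi]; ring
  · simp [cob, hx]
  · funext y
    have a := congrFun hf y
    simp only [wbd, one_mul, Fin.prod_univ_succ, Fin.cons_zero, Fin.cons_succ] at *
    by_cases hy : TupGood conf w y
    · have hp : ∏ l, w (y l) ≠ 0 := (Finset.prod_pos fun l _ => hy.2 l).ne'
      rw [Fin.prod_univ_succ] at hp
      rw [eq_div_iff hp, Finset.sum_mul] at a
      rw [← a]
      exact Finset.sum_congr rfl fun v _ => by ring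
    · rw [hgood y hy]
      refine Finset.sum_eq_zero fun v _ => ?_
      rw [cob, if_neg (fun h => hy (TupGood.of_cons h)), zero_mul]

end Abstract
section Hall

/-- Position sign of an element in a finite set. -/
noncomputable def sg {N : ℕ} (a : Fin N) (K : Finset (Fin N)) : ℝ :=
  (-1) ^ (K.filter (· < a)).card

theorem sg_lt {N : ℕ} {a b : Fin N} {K : Finset (Fin N)} (ha : a ∈ K)
    (hab : a < b) : sg a K * sg b (K.erase a) = - (sg b K * sg a (K.erase b)) := by
  have h1 : (K.erase b).filter (· < a) = K.filter (· < a) := by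
    ext c; simp only [Finset.mem_filter, Finset.mem_erase]
    constructor
    · rintro ⟨⟨_, h⟩, h'⟩; exact ⟨h, h'⟩
    · rintro ⟨h, h'⟩; exact ⟨⟨(h'.trans hab).ne, h⟩, h'⟩
  have h2 : (K.erase a).filter (· < b) = (K.filter (· < b)).erase a := by
    ext c; simp only [Finset.mem_filter, Finset.mem_erase]; tauto
  have h3 : ((K.erase a).filter (· < b)).card + 1 = (K.filter (· < b)).card := by
    rw [h2]; exact Finset.card_erase_add_one (by simp [ha, hab])
  unfold sg
  rw [h1, ← h3, pow_succ]; ring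

theorem sg_anti {N : ℕ} {a b : Fin N} {K : Finset (Fin N)} (ha : a ∈ K) (hb : b ∈ K)
    (hab : a ≠ b) : sg a K * sg b (K.erase a) = - (sg b K * sg a (K.erase b)) := by
  rcases lt_or_gt_of_ne hab with h | h
  · exact sg_lt ha h
  · rw [sg_lt hb h]; ring

/-- The signed sum of facets. -/
noncomputable def zc {N : ℕ} {X : Type*} (c : Finset (Fin N) → X → ℝ) (K : Finset (Fin N))
    (x : X) : ℝ := ∑ a ∈ K, sg a K * c (K.erase a) x

theorem zc_zc {N : ℕ} {X : Type*} (c : Finset (Fin N) → X → ℝ) (K : Finset (Fin N)) (x : X) :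
    zc (zc c) K x = 0 := by
  unfold zc
  have e : ∀ a ∈ K, sg a K * ∑ b ∈ K.erase a, sg b (K.erase a) * c ((K.erase a).erase b) x =
      ∑ b ∈ K, if a = b then 0 else
        sg a K * sg b (K.erase a) * c ((K.erase a).erase b) x := by
    intro a ha
    rw [← Finset.add_sum_erase K _ ha, if_pos rfl, zero_add, Finset.mul_sum]
    refine Finset.sum_congr rfl fun b hb => ?_
    rw [if_neg (Finset.ne_of_mem_erase hb).symm]; ring
  rw [Finset.sum_congr rfl e]
  have h : ∑ a ∈ K, ∑ b ∈ K, (if a = b then 0 else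
        sg a K * sg b (K.erase a) * c ((K.erase a).erase b) x) =
      - ∑ a ∈ K, ∑ b ∈ K, (if a = b then 0 else
        sg a K * sg b (K.erase a) * c ((K.erase a).erase b) x) := by
    conv_lhs => rw [Finset.sum_comm]
    rw [← Finset.sum_neg_distrib]
    refine Finset.sum_congr rfl fun a ha => ?_
    rw [← Finset.sum_neg_distrib]
    refine Finset.sum_congr rfl fun b hb => ?_
    by_cases hab : a = b
    · simp [hab]
    · rw [if_neg hab, if_neg (Ne.symm hab), sg_anti hb ha (Ne.symm hab), Finset.erase_right_comm]
      ring
  linarith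

open Classical in
theorem psi_step {V : Type*} [Fintype V] {N : ℕ} (α : V → Fin N) {k : ℕ}
    (t : Fin (k+2) → Fin N) (ht : Function.Injective t) (h : (Fin (k+2) → V) → ℝ) (ha : TupAlt h)
    (hs : ∀ x, h x ≠ 0 → ∀ i, α (x i) ∈ Finset.univ.image t) :
    (∑ y : Fin (k+1) → V, if ∀ i, α (y i) = t i.succ then wbd (fun _ => 1) h y else 0) =
    ∑ x : Fin (k+2) → V, if ∀ i, α (x i) = t i then h x else 0 := by
  have e1 : (∑ y : Fin (k+1) → V, if ∀ i, α (y i) = t i.succ then wbd (fun _ => 1) h y else 0) =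
      ∑ x : Fin (k+2) → V, if ∀ i : Fin (k+1), α (x i.succ) = t i.succ then h x else 0 := by
    rw [← (Fin.consEquiv (fun _ : Fin (k+2) => V)).sum_comp, Fintype.sum_prod_type, Finset.sum_comm]
    refine Finset.sum_congr rfl fun y _ => ?_
    have hc : ∀ v, Fin.consEquiv (fun _ : Fin (k+2) => V) (v, y) = (Fin.cons v y : Fin (k+2) → V) :=
      fun _ => rfl
    simp only [hc, Fin.cons_succ]
    split_ifs
    · simp [wbd]
    · simp
  have e2 : ∀ x : Fin (k+2) → V,
      (if ∀ i : Fin (k+1), α (x i.succ) = t i.succ then h x else 0) =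
      (if ∀ i, α (x i) = t i then h x else 0) + ∑ l : Fin (k+1),
        if (∀ i : Fin (k+1), α (x i.succ) = t i.succ) ∧ α (x 0) = t l.succ then h x else 0 := by
    intro x
    by_cases hx : h x = 0
    · simp [hx]
    by_cases hT : ∀ i : Fin (k+1), α (x i.succ) = t i.succ
    swap
    · have : ¬ ∀ i, α (x i) = t i := fun h' => hT fun i => h' i.succ
      simp [hT, this]
    have := hs x hx 0
    obtain ⟨l, -, hl⟩ := Finset.mem_image.1 this
    have hT' : (∀ i, α (x i) = t i) ↔ l = 0 := by
      constructor
      · intro h'; exact ht (hl.trans (h' 0))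
      · rintro rfl i
        refine Fin.cases hl.symm hT i
    rcases Fin.eq_zero_or_eq_succ l with rfl | ⟨l, rfl⟩
    · rw [if_pos hT, if_pos (hT'.2 rfl), Finset.sum_eq_zero, add_zero]
      intro l _
      rw [if_neg]
      rintro ⟨-, h'⟩
      exact Fin.succ_ne_zero l (ht (h'.symm.trans hl.symm))
    · rw [if_pos hT, if_neg (fun h' => Fin.succ_ne_zero l (hT'.1 h')), zero_add,
        Finset.sum_eq_single l, if_pos ⟨hT, hl.symm⟩]
      · intro b _ hb
        rw [if_neg]
        rintro ⟨-, h'⟩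
        exact hb (Fin.succ_injective _ (ht (h'.symm.trans hl.symm)))
      · simp
  rw [e1, Finset.sum_congr rfl fun x _ => e2 x, Finset.sum_add_distrib, Finset.sum_comm]
  rw [add_eq_left]
  refine Finset.sum_eq_zero fun l _ => ?_
  have e3 : ∑ x : Fin (k+2) → V,
        (if (∀ i : Fin (k+1), α (x i.succ) = t i.succ) ∧ α (x 0) = t l.succ then h x else 0) =
      - ∑ x : Fin (k+2) → V,
        (if (∀ i : Fin (k+1), α (x i.succ) = t i.succ) ∧ α (x 0) = t l.succ then h x else 0) := by
    conv_lhs => rw [← ((Equiv.swap (0 : Fin (k+2)) l.succ).arrowCongr (Equiv.refl V)).sum_comp]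
    rw [← Finset.sum_neg_distrib]
    refine Finset.sum_congr rfl fun x _ => ?_
    have hx : (Equiv.swap (0 : Fin (k+2)) l.succ).arrowCongr (Equiv.refl V) x =
        x ∘ Equiv.swap 0 l.succ := by
      funext i; simp [Equiv.arrowCongr]
    rw [hx, ha l.succ (Fin.succ_ne_zero l)]
    have : ((∀ i : Fin (k+1), α ((x ∘ Equiv.swap 0 l.succ) i.succ) = t i.succ) ∧
        α ((x ∘ Equiv.swap 0 l.succ) 0) = t l.succ) ↔
        ((∀ i : Fin (k+1), α (x i.succ) = t i.succ) ∧ α (x 0) = t l.succ) := by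
      have hne : ∀ i : Fin (k+1), i ≠ l → Equiv.swap 0 l.succ i.succ = i.succ := fun i hi =>
        Equiv.swap_apply_of_ne_of_ne (Fin.succ_ne_zero i) (fun e => hi (Fin.succ_injective _ e))
      simp only [Function.comp, Equiv.swap_apply_left]
      constructor
      · rintro ⟨h1, h2⟩
        refine ⟨fun i => ?_, ?_⟩
        · by_cases hi : i = l
          · rw [hi]; exact h2
          · have := h1 i; rwa [hne i hi] at this
        · have := h1 l; rwa [Equiv.swap_apply_right] at this
      · rintro ⟨h1, h2⟩
        refine ⟨fun i => ?_, h1 l⟩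
        by_cases hi : i = l
        · rw [hi, Equiv.swap_apply_right]; exact h2
        · rw [hne i hi]; exact h1 i
    simp only [this]
    split_ifs <;> simp
  linarith

theorem zc_congr {N : ℕ} {X : Type*} {c c' : Finset (Fin N) → X → ℝ} {K : Finset (Fin N)}
    (h : ∀ a ∈ K, c (K.erase a) = c' (K.erase a)) : zc c K = zc c' K := by
  funext x
  exact Finset.sum_congr rfl fun a ha => by rw [h a ha]

theorem wbd_zc {V : Type*} [Fintype V] {N : ℕ} {k : ℕ}
    (c : Finset (Fin N) → (Fin (k+1) → V) → ℝ) (K : Finset (Fin N)) :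
    wbd (fun _ => 1) (zc c K) = zc (fun K => wbd (fun _ => 1) (c K)) K := by
  funext y
  simp only [wbd, zc, one_mul, Finset.mul_sum]
  rw [Finset.sum_comm]

open Classical in
theorem hall_induct {V : Type*} [Fintype V] {N : ℕ} (α : V → Fin N) (conf : V → V → Prop)
    (act : V → Prop) (w : Finset (Fin N) → V → ℝ)
    (hwK : ∀ K v, 0 < w K v ↔ act v ∧ α v ∈ K)
    (δ : Fin N → V) (hδ : ∀ a, α (δ a) = a) (hδa : ∀ a, act (δ a))
    (hex : ∀ (j : ℕ) (K : Finset (Fin N)), K.card = j + 2 → ∀ g : (Fin (j+1) → V) → ℝ,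
      TupAlt g → (∀ x, ¬ TupGood conf (w K) x → g x = 0) → wbd (fun _ => 1) g = 0 →
      ∃ h : (Fin (j+2) → V) → ℝ, TupAlt h ∧ (∀ x, ¬ TupGood conf (w K) x → h x = 0) ∧
      wbd (fun _ => 1) h = g) (k : ℕ) :
    ∃ c : Finset (Fin N) → (Fin (k+1) → V) → ℝ,
      (∀ K, K.card = k + 1 → TupAlt (c K)) ∧
      (∀ K, K.card = k + 1 → ∀ x, ¬ TupGood conf (w K) x → c K x = 0) ∧
      (∀ K, K.card = k + 2 → wbd (fun _ => 1) (zc c K) = 0) ∧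
      (∀ t : Fin (k+1) → Fin N, StrictMono t →
        (∑ x : Fin (k+1) → V, if ∀ i, α (x i) = t i then c (Finset.univ.image t) x else 0) = 1) := by
  induction k with
  | zero =>
    have hsub : Subsingleton (Fin (0 + 1)) := inferInstanceAs (Subsingleton (Fin 1))
    refine ⟨fun K x => if ∃ a ∈ K, x 0 = δ a then 1 else 0, ?_, ?_, ?_, ?_⟩
    · intro K _ i hi
      exact absurd (Subsingleton.elim i 0) hi
    · intro K _ x hx
      refine if_neg ?_
      rintro ⟨a, ha, e⟩
      apply hx
      refine ⟨fun i l hil => absurd (Subsingleton.elim i l) hil, fun i => ?_⟩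
      rw [Subsingleton.elim i 0, e, hwK, hδ]
      exact ⟨hδa a, ha⟩
    · intro K hK
      rw [wbd_zc]
      have h1 : ∀ K : Finset (Fin N), K.card = 1 → (wbd (fun _ => 1)
          (fun x : Fin 1 → V => if ∃ a ∈ K, x 0 = δ a then (1:ℝ) else 0)) = fun _ => 1 := by
        intro K hK
        obtain ⟨a, rfl⟩ := Finset.card_eq_one.1 hK
        funext y
        simp [wbd]
      have h2 : zc (fun K => wbd (fun _ => 1)
          (fun x : Fin 1 → V => if ∃ a ∈ K, x 0 = δ a then (1:ℝ) else 0)) K =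
          zc (fun _ (_ : Fin 0 → V) => 1) K := by
        apply zc_congr
        intro a ha
        exact h1 _ (by rw [Finset.card_erase_of_mem ha, hK])
      rw [h2]
      obtain ⟨a, b, hab, rfl⟩ := Finset.card_eq_two.1 hK
      have h3 : ∀ a : Fin N, sg a {a} = 1 := by
        intro a; simp [sg, Finset.filter_singleton]
      have := sg_anti (a := a) (b := b) (K := {a, b}) (by simp) (by simp) hab
      have e1 : ({a, b} : Finset (Fin N)).erase a = {b} := by
        rw [Finset.erase_insert]; simpa using hab
      have e2 : ({a, b} : Finset (Fin N)).erase b = {a} := by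
        rw [Finset.pair_comm, Finset.erase_insert]; simpa using Ne.symm hab
      rw [e1, e2, h3, h3] at this
      funext y
      simp only [zc, mul_one, Finset.sum_pair hab, Pi.zero_apply]
      linarith
    · intro t ht
      rw [Finset.sum_eq_single (fun _ => δ (t 0))]
      · simp [hδ, Fin.forall_fin_one]
      · intro x _ hx
        by_cases h1 : ∀ i, α (x i) = t i
        swap
        · rw [if_neg h1]
        rw [if_pos h1]
        refine if_neg ?_
        rintro ⟨a, ha, e⟩
        apply hx
        funext i
        have ha' : a = t 0 := by rw [← h1 0, e, hδ]
        rw [Subsingleton.elim i 0, e, ha']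
      · simp
  | succ k ih =>
    obtain ⟨c, hc1, hc2, hc3, hc4⟩ := ih
    have card_e : ∀ {j : ℕ} {K : Finset (Fin N)} {a : Fin N}, K.card = j + 1 → a ∈ K →
        (K.erase a).card = j := by
      intro j K a hK ha
      rw [Finset.card_erase_of_mem ha, hK]; rfl
    have step : ∀ K : Finset (Fin N), ∃ h : (Fin (k+2) → V) → ℝ, K.card = k + 2 →
        TupAlt h ∧ (∀ x, ¬ TupGood conf (w K) x → h x = 0) ∧
        wbd (fun _ => 1) h = zc c K := by
      intro K
      by_cases hK : K.card = k + 2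
      swap
      · exact ⟨0, fun h => absurd h hK⟩
      have q1 : TupAlt (zc c K) := by
        intro i hi x
        unfold zc
        rw [← Finset.sum_neg_distrib]
        refine Finset.sum_congr rfl fun a ha => ?_
        rw [hc1 _ (card_e hK ha) i hi]; ring
      have q2 : ∀ x, ¬ TupGood conf (w K) x → zc c K x = 0 := by
        intro x hx
        refine Finset.sum_eq_zero fun a ha => ?_
        rw [hc2 _ (card_e hK ha), mul_zero]
        intro hg
        apply hx
        refine ⟨hg.1, fun i => ?_⟩
        have := (hwK _ _).1 (hg.2 i)
        exact (hwK _ _).2 ⟨this.1, Finset.mem_of_mem_erase this.2⟩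
      obtain ⟨h, hh⟩ := hex k K hK (zc c K) q1 q2 (hc3 K hK)
      exact ⟨h, fun _ => hh⟩
    choose c' hc' using step
    refine ⟨c', fun K hK => (hc' K hK).1, fun K hK => (hc' K hK).2.1, fun K hK => ?_, ?_⟩
    · rw [wbd_zc]
      have : zc (fun K => wbd (fun _ => 1) (c' K)) K = zc (zc c) K :=
        zc_congr fun a ha => (hc' _ (card_e hK ha)).2.2
      rw [this]
      funext x
      exact zc_zc c K x
    · intro t ht
      set K := Finset.univ.image t with hKdef
      have hK : K.card = k + 2 := by
        rw [hKdef, Finset.card_image_of_injective _ ht.injective]; simp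
      have ht0 : t 0 ∈ K := Finset.mem_image_of_mem _ (Finset.mem_univ _)
      obtain ⟨g1, g2, g3⟩ := hc' K hK
      rw [← psi_step α t ht.injective (c' K) g1, g3]
      · have hts : StrictMono (fun i : Fin (k+1) => t i.succ) := fun a b hab =>
          ht (Fin.succ_lt_succ_iff.2 hab)
        rw [← hc4 _ hts]
        have himg : Finset.univ.image (fun i : Fin (k+1) => t i.succ) = K.erase (t 0) := by
          ext a
          simp only [hKdef, Finset.mem_image, Finset.mem_univ, true_and, Finset.mem_erase]
          constructor
          · rintro ⟨i, rfl⟩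
            exact ⟨fun e => Fin.succ_ne_zero i (ht.injective e), _, rfl⟩
          · rintro ⟨hne, i, rfl⟩
            rcases Fin.eq_zero_or_eq_succ i with rfl | ⟨i, rfl⟩
            · exact absurd rfl hne
            · exact ⟨i, rfl⟩
        rw [himg]
        refine Finset.sum_congr rfl fun y _ => ?_
        split_ifs with hy
        swap
        · rfl
        have hsg : sg (t 0) K = 1 := by
          have : K.filter (· < t 0) = ∅ := by
            apply Finset.filter_eq_empty_iff.2
            intro a ha
            obtain ⟨i, -, rfl⟩ := Finset.mem_image.1 ha
            exact not_lt.2 (ht.monotone (Fin.zero_le i))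
          simp [sg, this]
        unfold zc
        rw [Finset.sum_eq_single (t 0), hsg, one_mul]
        · intro a ha hne
          obtain ⟨i, -, rfl⟩ := Finset.mem_image.1 ha
          rcases Fin.eq_zero_or_eq_succ i with rfl | ⟨i, rfl⟩
          · exact absurd rfl hne
          rw [hc2 _ (card_e hK ha), mul_zero]
          intro hg
          have := ((hwK _ _).1 (hg.2 i)).2
          rw [hy i] at this
          simp at this
        · intro h; exact absurd ht0 h
      · intro x hx i
        have hg : TupGood conf (w K) x := by
          by_contra hn
          exact hx (g2 x hn)
        exact ((hwK _ _).1 (hg.2 i)).2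

open Classical in
theorem hall_final {V : Type*} [Fintype V] {N : ℕ} (hN : 0 < N) (α : V → Fin N)
    (conf : V → V → Prop)
    (act : V → Prop) (w : Finset (Fin N) → V → ℝ)
    (hwK : ∀ K v, 0 < w K v ↔ act v ∧ α v ∈ K)
    (δ : Fin N → V) (hδ : ∀ a, α (δ a) = a) (hδa : ∀ a, act (δ a))
    (hex : ∀ (j : ℕ) (K : Finset (Fin N)), K.card = j + 2 → ∀ g : (Fin (j+1) → V) → ℝ,
      TupAlt g → (∀ x, ¬ TupGood conf (w K) x → g x = 0) → wbd (fun _ => 1) g = 0 →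
      ∃ h : (Fin (j+2) → V) → ℝ, TupAlt h ∧ (∀ x, ¬ TupGood conf (w K) x → h x = 0) ∧
      wbd (fun _ => 1) h = g) :
    ∃ x : Fin N → V, (∀ i, α (x i) = i) ∧ (∀ i, act (x i)) ∧
      ∀ i l, i ≠ l → ¬ conf (x i) (x l) := by
  obtain ⟨k, rfl⟩ : ∃ k, N = k + 1 := ⟨N - 1, by omega⟩
  obtain ⟨c, -, h2, -, h4⟩ := hall_induct α conf act w hwK δ hδ hδa hex k
  have h := h4 id strictMono_id
  obtain ⟨x, -, hx⟩ := Finset.exists_ne_zero_of_sum_ne_zero (h ▸ one_ne_zero)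
  have hx1 : ∀ i, α (x i) = id i := by
    by_contra hn
    exact hx (if_neg hn)
  rw [if_pos hx1] at hx
  have hg : TupGood conf (w (Finset.univ.image id)) x := by
    by_contra hn
    exact hx (h2 _ (by simp) x hn)
  exact ⟨x, hx1, fun i => ((hwK _ _).1 (hg.2 i)).1, hg.1⟩

end Hall
section Assembly

/-- Conflict relation on edges and dummy elements. -/
def cfl {n m : ℕ} : (Fin n × Fin n × Fin m) ⊕ Fin n → (Fin n × Fin n × Fin m) ⊕ Fin n → Prop
  | .inl e, .inl e' => e.2.1 = e'.2.1 ∨ e.2.2 = e'.2.2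
  | .inr _, .inr _ => True
  | _, _ => False

/-- The positive semidefinite kernel dominating the conflict relation. -/
def ker {n m : ℕ} : (Fin n × Fin n × Fin m) ⊕ Fin n → (Fin n × Fin n × Fin m) ⊕ Fin n → ℝ
  | .inl e, .inl e' => (if e.2.1 = e'.2.1 then 1 else 0) + (if e.2.2 = e'.2.2 then 1 else 0)
  | .inr _, .inr _ => 1
  | _, _ => 0

/-- The weights attached to a set of first coordinates. -/
noncomputable def wts {n m : ℕ} (f : Fin n × Fin n × Fin m → ℝ) (s : ℝ) (K : Finset (Fin n)) :
    (Fin n × Fin n × Fin m) ⊕ Fin n → ℝ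
  | .inl e => if e.1 ∈ K then f e else 0
  | .inr a => if a ∈ K then s / K.card else 0

theorem sq_kernel {E B : Type*} [Fintype E] [Fintype B] [DecidableEq B] (g : E → B) (F : E → ℝ) :
    0 ≤ ∑ e, ∑ e', (if g e = g e' then 1 else 0) * F e * F e' := by
  have : ∑ e, ∑ e', (if g e = g e' then 1 else 0) * F e * F e' =
      ∑ b, (∑ e, if g e = b then F e else 0) ^ 2 := by
    simp only [sq, Finset.sum_mul_sum]
    rw [Finset.sum_comm]
    conv_rhs => rw [Finset.sum_comm]
    rw [Finset.sum_comm]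
    refine Finset.sum_congr rfl fun e _ => ?_
    conv_rhs => rw [Finset.sum_comm]
    refine Finset.sum_congr rfl fun e' _ => ?_
    rw [Finset.sum_eq_single (g e)]
    · by_cases h : g e = g e'
      · simp [h]
      · simp [h, Ne.symm h]
    · intro b _ hb
      simp [Ne.symm hb]
    · simp
  rw [this]
  exact Finset.sum_nonneg fun b _ => sq_nonneg _

theorem ker_psd {n m : ℕ} (F : (Fin n × Fin n × Fin m) ⊕ Fin n → ℝ) :
    0 ≤ ∑ u, ∑ v, ker u v * F u * F v := by
  simp only [Fintype.sum_sum_type, ker, zero_mul, Finset.sum_const_zero, add_zero, zero_add,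
    add_mul, Finset.sum_add_distrib]
  have h1 := sq_kernel (fun e : Fin n × Fin n × Fin m => e.2.1) (fun e => F (.inl e))
  have h2 := sq_kernel (fun e : Fin n × Fin n × Fin m => e.2.2) (fun e => F (.inl e))
  have h3 : ∑ x : Fin n, ∑ y : Fin n, 1 * F (.inr x) * F (.inr y) = (∑ x, F (.inr x)) ^ 2 := by
    simp only [one_mul, sq, Finset.sum_mul_sum]
  rw [h3]
  positivity

theorem sum_deg {E B : Type*} [Fintype E] [Fintype B] [DecidableEq B] (g : E → B) (f : E → ℝ) :
    ∑ b, ∑ e, (if g e = b then f e else 0) = ∑ e, f e := by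
  rw [Finset.sum_comm]
  simp

open Classical in
theorem main_rainbow {n m : ℕ} (f : Fin n × Fin n × Fin m → ℝ) (hf : ∀ e, 0 ≤ f e)
    (D d : ℝ) (hD : 0 < D) (hd : 0 < d) (hn : 0 < n) (hnd : (n - 1 : ℝ) * d = 2 * D)
    (hA : ∀ v : Fin n, (∑ e, if e.1 = v then f e else 0) = D)
    (hB : ∀ v : Fin n, (∑ e, if e.2.1 = v then f e else 0) = D)
    (hC : ∀ v : Fin m, (∑ e, if e.2.2 = v then f e else 0) = d) :
    ∃ x : Fin n → (Fin n × Fin n × Fin m) ⊕ Fin n, (∀ i, Sum.elim Prod.fst id (x i) = i) ∧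
      (∀ i, Sum.elim (fun e => 0 < f e) (fun _ => True) (x i)) ∧
      ∀ i l, i ≠ l → ¬ cfl (x i) (x l) := by
  set s := D + d with hs
  have hs0 : 0 < s := by positivity
  have hsym : ∀ u v : (Fin n × Fin n × Fin m) ⊕ Fin n, cfl u v ↔ cfl v u := by
    rintro (u | u) (v | v) <;> simp [cfl, eq_comm]
  have hmsym : ∀ u v : (Fin n × Fin n × Fin m) ⊕ Fin n, ker u v = ker v u := by
    rintro (u | u) (v | v) <;> simp [ker, eq_comm]
  have hm : ∀ u v : (Fin n × Fin n × Fin m) ⊕ Fin n, (if cfl u v then 1 else 0) ≤ ker u v := by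
    rintro (u | u) (v | v)
    · by_cases h1 : u.2.1 = v.2.1 <;> by_cases h2 : u.2.2 = v.2.2 <;> simp [cfl, ker, h1, h2]
    all_goals simp [cfl, ker]
  have hwK : ∀ (K : Finset (Fin n)) v, 0 < wts f s K v ↔
      Sum.elim (fun e => 0 < f e) (fun _ => True) v ∧ Sum.elim Prod.fst id v ∈ K := by
    rintro K (e | a)
    · by_cases h : e.1 ∈ K <;> simp [wts, h]
    · by_cases h : a ∈ K
      · have : 0 < K.card := Finset.card_pos.2 ⟨a, h⟩
        simp only [wts, h, if_true, Sum.elim_inr, id, and_self, iff_true]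
        positivity
      · simp [wts, h]
  have hw0 : ∀ (K : Finset (Fin n)) v, 0 ≤ wts f s K v := by
    rintro K (e | a)
    · simp only [wts]; split_ifs
      · exact hf e
      · rfl
    · simp only [wts]; split_ifs
      · positivity
      · rfl
  refine hall_final hn (Sum.elim Prod.fst id) cfl _ (wts f s) hwK Sum.inr (fun a => rfl)
    (fun a => trivial) ?_
  intro j K hK g hg1 hg2 hg3
  have hKR : (K.card : ℝ) = j + 2 := by rw [hK]; push_cast; ring
  have hdum : ∑ a : Fin n, (if a ∈ K then s / K.card else 0) = s := by
    rw [Finset.sum_ite_mem, Finset.univ_inter, Finset.sum_const, nsmul_eq_mul, hKR]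
    field_simp
  refine exact_chain cfl (wts f s K) ker (hw0 K) hsym hmsym hm ker_psd s ?_ ?_ g hg1 hg2 hg3
  · rintro (e | a) _
    · simp only [Fintype.sum_sum_type, ker, wts, mul_zero, Finset.sum_const_zero, add_zero]
      rw [hs, ← hB e.2.1, ← hC e.2.2, ← Finset.sum_add_distrib]
      refine Finset.sum_le_sum fun e' _ => ?_
      have := hf e'
      have c1 : (e.2.1 = e'.2.1) ↔ (e'.2.1 = e.2.1) := eq_comm
      have c2 : (e.2.2 = e'.2.2) ↔ (e'.2.2 = e.2.2) := eq_comm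
      simp only [c1, c2]
      split_ifs <;> linarith
    · simp only [Fintype.sum_sum_type, ker, wts, mul_zero, Finset.sum_const_zero, zero_add, mul_one]
      exact hdum.le
  · have htot : ∑ e : Fin n × Fin n × Fin m, (if e.1 ∈ K then f e else 0) = (j + 2) * D := by
      have : ∀ e : Fin n × Fin n × Fin m, (if e.1 ∈ K then f e else 0) =
          ∑ a ∈ K, if e.1 = a then f e else 0 := by
        intro e; rw [Finset.sum_ite_eq]
      rw [Finset.sum_congr rfl fun e _ => this e, Finset.sum_comm,
        Finset.sum_congr rfl fun a _ => hA a, Finset.sum_const, nsmul_eq_mul, hKR]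
    simp only [Fintype.sum_sum_type, wts]
    rw [hdum, htot]
    have hjn : (j : ℝ) + 2 ≤ n := by
      rw [← hKR]
      exact_mod_cast (Finset.card_le_univ K).trans (by simp)
    have : (j : ℝ) * d < (n - 1) * d := mul_lt_mul_of_pos_right (by linarith) hd
    nlinarith

end Assembly

/-- For `n ≥ 2`, every `(n, n, n(n-1)/2)`-fractionally balanced tripartite
hypergraph has a matching of size `n - 1`. -/
theorem bm_n_n_choose2 (n : ℕ) (hn : 2 ≤ n)
    (H : Finset (Fin n × Fin n × Fin (n * (n - 1) / 2)))
    (hH : TriFracBalanced H) :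
    ∃ M, TriMatching H M ∧ M.card = n - 1 := by
  classical
  obtain ⟨f, ⟨hf, hfH, hA, hB, hC⟩, hne⟩ := hH
  obtain ⟨e0, he0⟩ : ∃ e, f e ≠ 0 := by
    by_contra hcon
    push Not at hcon
    exact hne (funext hcon)
  have he0 : 0 < f e0 := lt_of_le_of_ne (hf e0) (Ne.symm he0)
  set T := ∑ e, f e with hT
  have hT0 : 0 < T := Finset.sum_pos' (fun e _ => hf e) ⟨e0, Finset.mem_univ _, he0⟩
  have h2m : 2 * (n * (n - 1) / 2) = n * (n - 1) :=
    Nat.mul_div_cancel' (Nat.even_mul_pred_self n).two_dvd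
  have h2mR : 2 * ((n * (n - 1) / 2 : ℕ) : ℝ) = n * (n - 1 : ℝ) := by
    have h := congrArg (Nat.cast : ℕ → ℝ) h2m
    push_cast [Nat.cast_sub (show 1 ≤ n by omega)] at h
    exact_mod_cast h
  have hnR : (2 : ℝ) ≤ n := by exact_mod_cast hn
  have tA := sum_deg (fun e : Fin n × Fin n × Fin (n * (n - 1) / 2) => e.1) f
  have tB := sum_deg (fun e : Fin n × Fin n × Fin (n * (n - 1) / 2) => e.2.1) f
  have tC := sum_deg (fun e : Fin n × Fin n × Fin (n * (n - 1) / 2) => e.2.2) f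
  rw [Finset.sum_congr rfl fun a _ => hA a e0.1] at tA
  rw [Finset.sum_congr rfl fun a _ => hB a e0.2.1] at tB
  rw [Finset.sum_congr rfl fun a _ => hC a e0.2.2] at tC
  simp only [Finset.sum_const, Finset.card_univ, Fintype.card_fin, nsmul_eq_mul] at tA tB tC
  set D := ∑ e, (if e.1 = e0.1 then f e else 0) with hDdef
  set D' := ∑ e, (if e.2.1 = e0.2.1 then f e else 0) with hDdef'
  set d := ∑ e, (if e.2.2 = e0.2.2 then f e else 0) with hddef
  have hDD : D' = D := by
    have : (n : ℝ) * D' = n * D := by rw [tA, tB]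
    exact mul_left_cancel₀ (by positivity) this
  have hD0 : 0 < D := by
    by_contra h
    have : (n : ℝ) * D ≤ 0 := mul_nonpos_of_nonneg_of_nonpos (by positivity) (not_lt.1 h)
    linarith
  have hnd : (n - 1 : ℝ) * d = 2 * D := by
    have h1 : (n : ℝ) * ((n - 1) * d) = n * (2 * D) := by
      rw [← mul_assoc, ← h2mR, mul_assoc, tC]
      linarith
    exact mul_left_cancel₀ (by positivity) h1
  have hd0 : 0 < d := by
    by_contra h
    have : (n - 1 : ℝ) * d ≤ 0 :=
      mul_nonpos_of_nonneg_of_nonpos (by linarith) (not_lt.1 h)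
    linarith
  obtain ⟨x, hx1, hx2, hx3⟩ := main_rainbow f hf D d hD0 hd0 (by omega) hnd
    (fun v => hA v _) (fun v => (hB v _).trans hDD) (fun v => hC v _)
  set M0 : Finset (Fin n × Fin n × Fin (n * (n - 1) / 2)) :=
    Finset.univ.filter (fun e => ∃ i, x i = Sum.inl e) with hM0
  have hmatch : TriMatching H M0 := by
    refine ⟨fun e he => ?_, fun e he e' he' hne => ?_⟩
    · obtain ⟨i, hi⟩ := (Finset.mem_filter.1 he).2
      by_contra hc
      have := hx2 i
      rw [hi] at this
      simp [hfH e hc] at this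
    · obtain ⟨i, hi⟩ := (Finset.mem_filter.1 he).2
      obtain ⟨l, hl⟩ := (Finset.mem_filter.1 he').2
      have hil : i ≠ l := by
        rintro rfl
        rw [hi] at hl
        exact hne (Sum.inl_injective hl)
      have h3 := hx3 i l hil
      rw [hi, hl] at h3
      have h1 := hx1 i
      have h1' := hx1 l
      rw [hi] at h1
      rw [hl] at h1'
      simp only [Sum.elim_inl] at h1 h1'
      simp only [cfl, not_or] at h3
      exact ⟨by rw [h1, h1']; exact hil, h3⟩
  have hcard : n - 1 ≤ M0.card := by
    have hJ : ∃ J : Finset (Fin n), n - 1 ≤ J.card ∧ ∀ i ∈ J, ∃ e, x i = Sum.inl e := by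
      by_cases h : ∃ i0 a, x i0 = Sum.inr a
      · obtain ⟨i0, a, h0⟩ := h
        refine ⟨Finset.univ.erase i0, by simp, fun i hi => ?_⟩
        rcases hxi : x i with e | b
        · exact ⟨e, rfl⟩
        · have := hx3 i i0 (Finset.ne_of_mem_erase hi)
          rw [hxi, h0] at this
          exact absurd trivial this
      · push Not at h
        refine ⟨Finset.univ, by simp, fun i _ => ?_⟩
        rcases hxi : x i with e | b
        · exact ⟨e, rfl⟩
        · exact absurd hxi (h i b)
    obtain ⟨J, hJ1, hJ2⟩ := hJ
    refine hJ1.trans ((Finset.card_le_card ?_).trans (Finset.card_image_le (f := Prod.fst)))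
    intro i hi
    obtain ⟨e, he⟩ := hJ2 i hi
    refine Finset.mem_image.2 ⟨e, Finset.mem_filter.2 ⟨Finset.mem_univ _, i, he⟩, ?_⟩
    have := hx1 i
    rwa [he] at this
  obtain ⟨M, hM, hMc⟩ := Finset.exists_subset_card_eq hcard
  exact ⟨M, ⟨hM.trans hmatch.1, fun e he e' he' => hmatch.2 e (hM he) e' (hM he')⟩, hMc⟩
end
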